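/- arXiv:1206.3095 — 11 statements merged into one kernel-verified Lean document; each statement's English description precedes it below -/
import Mathlib

section
/- Let S be a monoid, let (X_i, φ_{i,j}) be a direct system of right S-acts over a directed preorder I and let (X, α_i) be a directed colimit cone. If every X_i satisfies condition (P), then X satisfies condition (P). -/
open MulOpposite Function

universe u v

variable (S : Type u) [Monoid S]

/-- `f` is a map of right `S`-acts (where a right `S`-act is a `MulAction Sᵐᵒᵖ`-type,
the right action being `a • s := op s • a`). -/
def IsSMap {A B : Type*} [MulAction Sᵐᵒᵖ A] [MulAction Sᵐᵒᵖ B] (f : A → B) : Prop :=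
  ∀ (s : S) (a : A), f (op s • a) = op s • f a

/-- `(Xs, φ)` is a direct system of right `S`-acts over the preorder `I`. -/
def IsDirectSystem {I : Type v} [Preorder I] (Xs : I → Type u)
    [∀ i, MulAction Sᵐᵒᵖ (Xs i)] (φ : ∀ i j, i ≤ j → Xs i → Xs j) : Prop :=
  (∀ i j (h : i ≤ j), IsSMap S (φ i j h)) ∧
  (∀ i (x : Xs i), φ i i le_rfl x = x) ∧
  (∀ i j k (hij : i ≤ j) (hjk : j ≤ k) (x : Xs i),
    φ j k hjk (φ i j hij x) = φ i k (hij.trans hjk) x)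

/-- `(X, α)` is a directed colimit cone over the direct system `(Xs, φ)`. -/
def IsColimitCone {I : Type v} [Preorder I] (Xs : I → Type u)
    [∀ i, MulAction Sᵐᵒᵖ (Xs i)] (φ : ∀ i j, i ≤ j → Xs i → Xs j)
    (X : Type u) [MulAction Sᵐᵒᵖ X] (α : ∀ i, Xs i → X) : Prop :=
  (∀ i, IsSMap S (α i)) ∧
  (∀ i j (h : i ≤ j) (x : Xs i), α j (φ i j h x) = α i x) ∧
  (∀ x : X, ∃ i, ∃ xi : Xs i, α i xi = x) ∧
  (∀ i j (xi : Xs i) (xj : Xs j),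
    α i xi = α j xj ↔ ∃ k, ∃ (hik : i ≤ k) (hjk : j ≤ k), φ i k hik xi = φ j k hjk xj)

/-- A right `S`-act `A` satisfies condition (P). -/
def CondP (A : Type v) [MulAction Sᵐᵒᵖ A] : Prop :=
  ∀ (a a' : A) (u u' : S), op u • a = op u' • a' →
    ∃ (a'' : A) (s s' : S), a = op s • a'' ∧ a' = op s' • a'' ∧ s * u = s' * u'

/-- A directed colimit of right `S`-acts satisfying condition (P)
satisfies condition (P). -/
theorem condP_of_directed_colimit {I : Type v} [Preorder I] [IsDirected I (· ≤ ·)]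
    (Xs : I → Type u) [∀ i, MulAction Sᵐᵒᵖ (Xs i)]
    (φ : ∀ i j, i ≤ j → Xs i → Xs j) (hsys : IsDirectSystem S Xs φ)
    (X : Type u) [MulAction Sᵐᵒᵖ X] (α : ∀ i, Xs i → X)
    (hcolim : IsColimitCone S Xs φ X α)
    (hP : ∀ i, CondP S (Xs i)) : CondP S X := by
  obtain ⟨hφ, -, -⟩ := hsys
  obtain ⟨hα, hcomp, hsurj, heq⟩ := hcolim
  intro a a' u u' h
  obtain ⟨i, x, rfl⟩ := hsurj a
  obtain ⟨j, y, rfl⟩ := hsurj a'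
  rw [← hα, ← hα, heq] at h
  obtain ⟨k, hik, hjk, hk⟩ := h
  rw [hφ, hφ] at hk
  obtain ⟨z, s, s', hx, hy, hs⟩ := hP k _ _ u u' hk
  refine ⟨α k z, s, s', ?_, ?_, hs⟩
  · rw [← hcomp i k hik, hx, hα]
  · rw [← hcomp j k hjk, hy, hα]
end

section
/- Let S be a monoid, let I be a directed preorder, let (X_i, φ_{i,j}) and (Y_i, θ_{i,j}) be direct systems of right S-acts over I with directed colimit cones (X, β_i) and (Y, α_i) respectively, and for each i ∈ I let ψ_i : X_i → Y_i be a pure epimorphism such that ψ_j∘φ_{i,j} = θ_{i,j}∘ψ_i for all i ≤ j. Let ψ : X → Y be an S-map such that ψ∘β_i = α_i∘ψ_i for all i ∈ I. Then ψ is a pure epimorphism. -/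
open MulOpposite Function

universe u v

variable (S : Type u) [Monoid S]

/-- A surjective `S`-map `ψ : X → Y` is a pure epimorphism: every finite family of
elements of `Y` satisfying a finite family of relations lifts, with the relations. -/
def IsPureEpi {X Y : Type*} [MulAction Sᵐᵒᵖ X] [MulAction Sᵐᵒᵖ Y] (ψ : X → Y) : Prop :=
  Surjective ψ ∧
    ∀ (n m : ℕ) (y : Fin n → Y) (j k : Fin m → Fin n) (s t : Fin m → S),
      (∀ i : Fin m, op (s i) • y (j i) = op (t i) • y (k i)) →
      ∃ x : Fin n → X, (∀ r, ψ (x r) = y r) ∧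
        ∀ i : Fin m, op (s i) • x (j i) = op (t i) • x (k i)

section DirectedColimit

variable {S} {I : Type v} [Preorder I] [IsDirected I (· ≤ ·)] {Ys : I → Type u}
  [∀ i, MulAction Sᵐᵒᵖ (Ys i)] {θ : ∀ i j, i ≤ j → Ys i → Ys j}
  {Y : Type u} [MulAction Sᵐᵒᵖ Y] {α : ∀ i, Ys i → Y}

/-- A finite family of elements of a directed colimit comes from a single stage. -/
theorem IsColimitCone.exists_finite_lift [Nonempty I] (h : IsColimitCone S Ys θ Y α)
    {ι : Type*} [Finite ι] (y : ι → Y) : ∃ i, ∃ z : ι → Ys i, ∀ r, α i (z r) = y r := by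
  obtain ⟨-, hα, hsurj, -⟩ := h
  choose d z hz using fun r => hsurj (y r)
  obtain ⟨i, hi⟩ := Finite.exists_le d
  exact ⟨i, fun r => θ (d r) i (hi r) (z r), fun r => (hα _ _ _ _).trans (hz r)⟩

/-- Finitely many equalities in a directed colimit between elements of one stage already hold
at some later stage. -/
theorem IsColimitCone.exists_finite_eq (hsys : IsDirectSystem S Ys θ)
    (h : IsColimitCone S Ys θ Y α) {ι : Type*} [Finite ι] {i : I} (a b : ι → Ys i)
    (hab : ∀ r, α i (a r) = α i (b r)) :
    ∃ k, ∃ hik : i ≤ k, ∀ r, θ i k hik (a r) = θ i k hik (b r) := by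
  obtain ⟨-, -, hθ⟩ := hsys
  obtain ⟨-, -, -, heq⟩ := h
  choose d hd _ hd' using fun r => (heq i i (a r) (b r)).1 (hab r)
  have : Nonempty I := ⟨i⟩
  obtain ⟨l, hl⟩ := Finite.exists_le d
  obtain ⟨k, hik, hlk⟩ := exists_ge_ge i l
  refine ⟨k, hik, fun r => ?_⟩
  rw [← hθ i (d r) k (hd r) ((hl r).trans hlk), ← hθ i (d r) k (hd r) ((hl r).trans hlk), hd' r]

end DirectedColimit

/-- A directed colimit of pure epimorphisms is a pure epimorphism. -/
theorem isPureEpi_of_directed_colimit {I : Type v} [Preorder I] [IsDirected I (· ≤ ·)]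
    (Xs Ys : I → Type u) [∀ i, MulAction Sᵐᵒᵖ (Xs i)] [∀ i, MulAction Sᵐᵒᵖ (Ys i)]
    (φ : ∀ i j, i ≤ j → Xs i → Xs j) (θ : ∀ i j, i ≤ j → Ys i → Ys j)
    (hsysX : IsDirectSystem S Xs φ) (hsysY : IsDirectSystem S Ys θ)
    (X Y : Type u) [MulAction Sᵐᵒᵖ X] [MulAction Sᵐᵒᵖ Y]
    (β : ∀ i, Xs i → X) (α : ∀ i, Ys i → Y)
    (hcolimX : IsColimitCone S Xs φ X β) (hcolimY : IsColimitCone S Ys θ Y α)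
    (ψi : ∀ i, Xs i → Ys i) (hψi : ∀ i, IsPureEpi S (ψi i))
    (hsq : ∀ i j (h : i ≤ j) (x : Xs i), ψi j (φ i j h x) = θ i j h (ψi i x))
    (ψ : X → Y) (hψmap : IsSMap S ψ)
    (hcompat : ∀ i (x : Xs i), ψ (β i x) = α i (ψi i x)) :
    IsPureEpi S ψ := by
  refine ⟨fun y => ?_, fun n m y j k s t hy => ?_⟩
  · obtain ⟨i, z, rfl⟩ := hcolimY.2.2.1 y
    obtain ⟨x, rfl⟩ := (hψi i).1 z
    exact ⟨β i x, hcompat i x⟩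
  rcases isEmpty_or_nonempty I with hI | hI
  · have hY : IsEmpty Y := ⟨fun y => hI.elim (hcolimY.2.2.1 y).choose⟩
    exact ⟨fun r => hY.elim (y r), fun r => hY.elim (y r), fun i => hY.elim (y (j i))⟩
  obtain ⟨i, z, hz⟩ := hcolimY.exists_finite_lift y
  obtain ⟨l, hil, hl⟩ := hcolimY.exists_finite_eq hsysY
    (fun r => op (s r) • z (j r)) (fun r => op (t r) • z (k r))
    (fun r => by rw [hcolimY.1 i, hcolimY.1 i, hz, hz, hy])
  obtain ⟨x, hx, hrel⟩ := (hψi l).2 n m (fun r => θ i l hil (z r)) j k s t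
    (fun r => by rw [← hsysY.1 i l hil, ← hsysY.1 i l hil, hl])
  refine ⟨fun r => β l (x r), fun r => ?_, fun r => ?_⟩
  · rw [hcompat, hx, hcolimY.2.1, hz]
  · rw [← hcolimX.1 l, ← hcolimX.1 l, hrel]
end

section
/- Let S be a monoid, let B, C, D be right S-acts, let β : B → D and ψ : C → D be S-maps and suppose ψ is a pure epimorphism. Let A = {(b, c) ∈ B × C : β(b) = ψ(c)} be the pullback, a right S-act under the componentwise action, and let φ : A → B be the first projection. Then φ is a pure epimorphism. -/
open MulOpposite Function

universe u v

variable (S : Type u) [Monoid S]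

variable {S}

/-- The pullback `{(b, c) ∈ B × C : β b = ψ c}` of two `S`-maps, as a subact of `B × C`
(with the componentwise action). -/
def actPullback {B C D : Type u} [MulAction Sᵐᵒᵖ B] [MulAction Sᵐᵒᵖ C] [MulAction Sᵐᵒᵖ D]
    (β : B →[Sᵐᵒᵖ] D) (ψ : C →[Sᵐᵒᵖ] D) : SubMulAction Sᵐᵒᵖ (B × C) where
  carrier := {p : B × C | β p.1 = ψ p.2}
  smul_mem' := by
    intro s p hp
    show β (s • p).1 = ψ (s • p).2
    rw [Prod.smul_fst, Prod.smul_snd, map_smul, map_smul]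
    exact congrArg (s • ·) hp

variable (S)

/-- The pullback of a pure epimorphism along any `S`-map is a pure
epimorphism (witnessed by the first projection of the pullback). -/
theorem isPureEpi_pullback_fst {B C D : Type u}
    [MulAction Sᵐᵒᵖ B] [MulAction Sᵐᵒᵖ C] [MulAction Sᵐᵒᵖ D]
    (β : B →[Sᵐᵒᵖ] D) (ψ : C →[Sᵐᵒᵖ] D) (hψ : IsPureEpi S (ψ : C → D)) :
    IsPureEpi S (fun a : actPullback β ψ => (a : B × C).1) := by
  refine ⟨fun b => ?_, fun n m y j k s t h => ?_⟩
  · obtain ⟨c, hc⟩ := hψ.1 (β b)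
    exact ⟨⟨(b, c), hc.symm⟩, rfl⟩
  · obtain ⟨x, hx, hrel⟩ := hψ.2 n m (fun r => β (y r)) j k s t fun i => by
      rw [← map_smul, ← map_smul, h i]
    exact ⟨fun r => ⟨(y r, x r), (hx r).symm⟩, fun _ => rfl,
      fun i => Subtype.ext (Prod.ext (h i) (hrel i))⟩
end

section
/- Let S be a monoid and let ψ : X → Y be a surjective S-map between right S-acts. Then ψ is a pure epimorphism if and only if ψ is a directed colimit of split epimorphisms, i.e. there exist a directed preorder I, direct systems (X_i, θ_{i,j}) and (Y_i, φ_{i,j}) of right S-acts over I, directed colimit cones (X, β_i) and (Y, α_i), and S-maps ψ_i : X_i → Y_i for each i ∈ I such that: each ψ_i is a split epimorphism (there is an S-map σ_i : Y_i → X_i with ψ_i∘σ_i = id), ψ_j∘θ_{i,j} = φ_{i,j}∘ψ_i for all i ≤ j, and ψ∘β_i = α_i∘ψ_i for all i ∈ I. -/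
open MulOpposite Function

universe u v

variable (S : Type u) [Monoid S]

/-- A witness that `ψ : X → Y` is a directed colimit of split epimorphisms: a directed
preorder `I`, direct systems `(Xs, θ)` and `(Ys, φ)` with directed colimit cones
`(X, β)` and `(Y, α)`, and split epimorphisms `ψi : Xs i → Ys i` commuting with the
systems and with `ψ`. -/
structure DirColimitOfSplitEpis (X Y : Type u) [MulAction Sᵐᵒᵖ X] [MulAction Sᵐᵒᵖ Y]
    (ψ : X → Y) where
  I : Type u
  [pre : Preorder I]
  directed : IsDirected I (· ≤ ·)
  Xs : I → Type u
  Ys : I → Type u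
  [actX : ∀ i, MulAction Sᵐᵒᵖ (Xs i)]
  [actY : ∀ i, MulAction Sᵐᵒᵖ (Ys i)]
  θ : ∀ i j, i ≤ j → Xs i → Xs j
  φ : ∀ i j, i ≤ j → Ys i → Ys j
  sysX : IsDirectSystem S Xs θ
  sysY : IsDirectSystem S Ys φ
  β : ∀ i, Xs i → X
  α : ∀ i, Ys i → Y
  colimX : IsColimitCone S Xs θ X β
  colimY : IsColimitCone S Ys φ Y α
  ψi : ∀ i, Xs i → Ys i
  ψi_sMap : ∀ i, IsSMap S (ψi i)
  ψi_split : ∀ i, ∃ σ : Ys i → Xs i, IsSMap S σ ∧ ∀ y : Ys i, ψi i (σ y) = y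
  square : ∀ i j (h : i ≤ j) (x : Xs i), ψi j (θ i j h x) = φ i j h (ψi i x)
  compat : ∀ i (x : Xs i), ψ (β i x) = α i (ψi i x)

section Lifting

variable {S} {I : Type v} [Preorder I] [IsDirectedOrder I] {Ys : I → Type u}
  [∀ i, MulAction Sᵐᵒᵖ (Ys i)] {φ : ∀ i j, i ≤ j → Ys i → Ys j}
  {Y : Type u} [MulAction Sᵐᵒᵖ Y] {α : ∀ i, Ys i → Y}

/-- Finitely many elements of a directed colimit satisfying finitely many relations come
from elements of a single stage which already satisfy these relations. -/
theorem IsColimitCone.exists_lift [Nonempty I] (hsys : IsDirectSystem S Ys φ)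
    (hcol : IsColimitCone S Ys φ Y α) {n m : ℕ} (y : Fin n → Y) (j k : Fin m → Fin n)
    (s t : Fin m → S) (h : ∀ i, op (s i) • y (j i) = op (t i) • y (k i)) :
    ∃ l, ∃ z : Fin n → Ys l, (∀ r, α l (z r) = y r) ∧
      ∀ i, op (s i) • z (j i) = op (t i) • z (k i) := by
  obtain ⟨hα, hαφ, hsurj, heq⟩ := hcol
  obtain ⟨hφ, -, hcomp⟩ := hsys
  choose a w hw using fun r => hsurj (y r)
  obtain ⟨b, hb⟩ := Finite.exists_le a
  have hrel : ∀ i, ∃ c, ∃ hc : b ≤ c,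
      op (s i) • φ _ c ((hb (j i)).trans hc) (w (j i)) =
        op (t i) • φ _ c ((hb (k i)).trans hc) (w (k i)) := by
    intro i
    have : α b (op (s i) • φ _ b (hb (j i)) (w (j i))) =
        α b (op (t i) • φ _ b (hb (k i)) (w (k i))) := by
      rw [hα, hα, hαφ, hαφ, hw, hw, h]
    obtain ⟨c, hc, _, e⟩ := (heq _ _ _ _).1 this
    rw [hφ, hφ, hcomp, hcomp] at e
    exact ⟨c, hc, e⟩
  choose c hbc hc using hrel
  obtain ⟨d, hd⟩ := Finite.exists_le c
  obtain ⟨l, hbl, hdl⟩ := exists_ge_ge b d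
  refine ⟨l, fun r => φ _ l ((hb r).trans hbl) (w r), fun r => by rw [hαφ, hw], fun i => ?_⟩
  have := congrArg (φ (c i) l ((hd i).trans hdl)) (hc i)
  rwa [hφ, hφ, hcomp, hcomp] at this

end Lifting

theorem DirColimitOfSplitEpis.isPureEpi {X Y : Type u} [MulAction Sᵐᵒᵖ X]
    [MulAction Sᵐᵒᵖ Y] {ψ : X → Y} (hψ : Surjective ψ) (D : DirColimitOfSplitEpis S X Y ψ) :
    IsPureEpi S ψ := by
  obtain ⟨I, hI, Xs, Ys, θ, φ, _, sysY, β, α, colimX, colimY, ψi, _, split, _, compat⟩ := D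
  refine ⟨hψ, fun n m y j k s t h => ?_⟩
  rcases Nat.eq_zero_or_pos n with rfl | hn
  · exact ⟨Fin.elim0, fun r => r.elim0, fun i => (j i).elim0⟩
  have : Nonempty I := let ⟨i, _⟩ := colimY.2.2.1 (y ⟨0, hn⟩); ⟨i⟩
  obtain ⟨l, z, hz, hrel⟩ := colimY.exists_lift sysY y j k s t h
  obtain ⟨σ, hσ, hσψ⟩ := split l
  refine ⟨fun r => β l (σ (z r)), fun r => by rw [compat, hσψ, hz], fun i => ?_⟩
  rw [← colimX.1, ← colimX.1, ← hσ, ← hσ, hrel]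

section Presentation

variable (Y : Type u) [MulAction Sᵐᵒᵖ Y]

/-- The relations holding in `Y` between elements `(y, s)`, read as `y • s`, of the free
act on the set `Y`. -/
abbrev ActRelation : Type u :=
  {p : (Y × S) × (Y × S) // op p.1.2 • p.1.1 = op p.2.2 • p.2.1}

variable {S Y}

/-- The quotient of the free act on `Y` by the congruence generated by the relations in `R`. -/
def PresentedAct (R : Finset (ActRelation S Y)) : Type u :=
  Quot fun a b : Y × S => ∃ p ∈ R, ∃ u : S,
    a = (p.1.1.1, p.1.1.2 * u) ∧ b = (p.1.2.1, p.1.2.2 * u)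

namespace PresentedAct

variable {R R' : Finset (ActRelation S Y)}

/-- The class of the element `y • s` of the free act. -/
def mk (R : Finset (ActRelation S Y)) (y : Y) (s : S) : PresentedAct R := Quot.mk _ (y, s)

theorem ind {P : PresentedAct R → Prop} (h : ∀ y s, P (mk R y s)) (a : PresentedAct R) : P a :=
  Quot.ind (fun b => h b.1 b.2) a

theorem mk_eq_mk {p : ActRelation S Y} (hp : p ∈ R) (u : S) :
    mk R p.1.1.1 (p.1.1.2 * u) = mk R p.1.2.1 (p.1.2.2 * u) :=
  Quot.sound ⟨p, hp, u, rfl, rfl⟩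

/-- A function on the free act that respects the relations in `R` descends to the quotient. -/
def lift {Z : Type*} (f : Y → S → Z)
    (hf : ∀ p ∈ R, ∀ u, f p.1.1.1 (p.1.1.2 * u) = f p.1.2.1 (p.1.2.2 * u)) :
    PresentedAct R → Z :=
  Quot.lift (fun a => f a.1 a.2) (by rintro _ _ ⟨p, hp, u, rfl, rfl⟩; exact hf p hp u)

@[simp]
theorem lift_mk {Z : Type*} (f : Y → S → Z)
    (hf : ∀ p ∈ R, ∀ u, f p.1.1.1 (p.1.1.2 * u) = f p.1.2.1 (p.1.2.2 * u)) (y : Y) (s : S) :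
    lift f hf (mk R y s) = f y s :=
  rfl

instance : MulAction Sᵐᵒᵖ (PresentedAct R) where
  smul u := lift (fun y s => mk R y (s * u.unop)) fun p hp v => by
    simpa only [mul_assoc] using mk_eq_mk hp (v * u.unop)
  one_smul := ind fun y s => congrArg (mk R y) (mul_one s)
  mul_smul u v := ind fun y s => congrArg (mk R y) (mul_assoc s v.unop u.unop).symm

@[simp]
theorem smul_mk (u : S) (y : Y) (s : S) : op u • mk R y s = mk R y (s * u) :=
  rfl

/-- The quotient map between the acts presented by `R ⊆ R'`. -/
def map (h : R ≤ R') : PresentedAct R → PresentedAct R' :=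
  lift (mk R') fun _ hp u => mk_eq_mk (h hp) u

@[simp]
theorem map_mk (h : R ≤ R') (y : Y) (s : S) : map h (mk R y s) = mk R' y s :=
  rfl

/-- The `S`-map out of a presented act given by images of the generators satisfying the
relations. -/
def desc {Z : Type*} [MulAction Sᵐᵒᵖ Z] (g : Y → Z)
    (hg : ∀ p ∈ R, op p.1.1.2 • g p.1.1.1 = op p.1.2.2 • g p.1.2.1) : PresentedAct R → Z :=
  lift (fun y s => op s • g y) fun p hp u => by
    simp only [op_mul, mul_smul, hg p hp]

@[simp]
theorem desc_mk {Z : Type*} [MulAction Sᵐᵒᵖ Z] (g : Y → Z)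
    (hg : ∀ p ∈ R, op p.1.1.2 • g p.1.1.1 = op p.1.2.2 • g p.1.2.1) (y : Y) (s : S) :
    desc g hg (mk R y s) = op s • g y :=
  rfl

theorem isSMap_desc {Z : Type*} [MulAction Sᵐᵒᵖ Z] (g : Y → Z)
    (hg : ∀ p ∈ R, op p.1.1.2 • g p.1.1.1 = op p.1.2.2 • g p.1.2.1) : IsSMap S (desc g hg) :=
  fun u => ind fun y s => by simp only [smul_mk, desc_mk, op_mul, mul_smul]

/-- The `S`-map to `Y` induced by the identity on generators. -/
def toAct (R : Finset (ActRelation S Y)) : PresentedAct R → Y :=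
  desc id fun p _ => p.2

@[simp]
theorem toAct_mk (y : Y) (s : S) : toAct R (mk R y s) = op s • y :=
  rfl

theorem isDirectSystem : IsDirectSystem S (fun R : Finset (ActRelation S Y) => PresentedAct R)
    fun _ _ h => map h :=
  ⟨fun _ _ _ _ => ind fun _ _ => rfl, fun _ => ind fun _ _ => rfl,
    fun _ _ _ _ _ => ind fun _ _ => rfl⟩

theorem isColimitCone : IsColimitCone S (fun R : Finset (ActRelation S Y) => PresentedAct R)
    (fun _ _ h => map h) Y toAct := by
  classical
  have hcomp : ∀ (R R' : Finset (ActRelation S Y)) (h : R ≤ R') (a : PresentedAct R),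
      toAct R' (map h a) = toAct R a := fun _ _ _ => ind fun _ _ => rfl
  refine ⟨fun R => isSMap_desc _ _, hcomp, fun y => ⟨∅, mk ∅ y 1, by simp⟩,
    fun R R' a b => ⟨?_, fun ⟨Q, h, h', e⟩ => ?_⟩⟩
  · induction a using ind with | h y s
    induction b using ind with | h z t
    intro e
    let p : ActRelation S Y := ⟨((y, s), (z, t)), e⟩
    refine ⟨insert p (R ∪ R'), fun q hq => by simp [hq], fun q hq => by simp [hq], ?_⟩
    simpa [p] using mk_eq_mk (Finset.mem_insert_self p (R ∪ R')) 1
  · exact (hcomp _ _ h a).symm.trans ((congrArg (toAct Q) e).trans (hcomp _ _ h' b))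

end PresentedAct

/-- A pure epimorphism has a set-theoretic section respecting any given finite set of
relations. -/
theorem IsPureEpi.exists_section {X : Type*} [MulAction Sᵐᵒᵖ X] {ψ : X → Y}
    (hψ : IsPureEpi S ψ) (R : Finset (ActRelation S Y)) :
    ∃ g : Y → X, (∀ y, ψ (g y) = y) ∧
      ∀ p ∈ R, op p.1.1.2 • g p.1.1.1 = op p.1.2.2 • g p.1.2.1 := by
  classical
  let A : Finset Y := R.image (fun p => p.1.1.1) ∪ R.image fun p => p.1.2.1
  have hj : ∀ p ∈ R, p.1.1.1 ∈ A := fun p hp =>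
    Finset.mem_union_left _ (Finset.mem_image_of_mem _ hp)
  have hk : ∀ p ∈ R, p.1.2.1 ∈ A := fun p hp =>
    Finset.mem_union_right _ (Finset.mem_image_of_mem _ hp)
  let e := A.equivFin
  let f := R.equivFin
  obtain ⟨x, hx, hrel⟩ := hψ.2 _ _ (fun r => (e.symm r : Y))
    (fun i => e ⟨_, hj _ (f.symm i).2⟩) (fun i => e ⟨_, hk _ (f.symm i).2⟩)
    (fun i => (f.symm i).1.1.1.2) (fun i => (f.symm i).1.1.2.2)
    (fun i => by simpa using (f.symm i).1.2)
  refine ⟨fun y => if hy : y ∈ A then x (e ⟨y, hy⟩) else surjInv hψ.1 y, fun y => ?_,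
    fun p hp => ?_⟩
  · dsimp only
    split_ifs with hy
    · simp [hx]
    · exact surjInv_eq hψ.1 y
  · have := hrel (f ⟨p, hp⟩)
    simp only [Equiv.symm_apply_apply] at this
    simpa only [dif_pos (hj p hp), dif_pos (hk p hp)] using this

end Presentation

section Pullback

variable {S} {A B C : Type*} [MulAction Sᵐᵒᵖ A] [MulAction Sᵐᵒᵖ B] [MulAction Sᵐᵒᵖ C]

/-- The pullback of two `S`-maps, as a right `S`-act. -/
abbrev pullbackAct {f : A → C} {g : B → C} (hf : IsSMap S f) (hg : IsSMap S g) :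
    MulAction Sᵐᵒᵖ (f.Pullback g) where
  smul u p := ⟨u • p.1, by
    have h : f p.1.1 = g p.1.2 := p.2
    change f (op u.unop • p.1.1) = g (op u.unop • p.1.2)
    rw [hf, hg, h]⟩
  one_smul p := Subtype.ext (one_smul _ p.1)
  mul_smul u v p := Subtype.ext (mul_smul u v p.1)

end Pullback

/-- A pure epimorphism `X → Y` is the directed colimit of its pullbacks along the canonical
maps to `Y` from the quotients of the free act on `Y` by finitely many relations. -/
theorem IsPureEpi.nonempty_dirColimitOfSplitEpis {X Y : Type u} [MulAction Sᵐᵒᵖ X]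
    [MulAction Sᵐᵒᵖ Y] {ψ : X → Y} (hψ : IsPureEpi S ψ) (hmap : IsSMap S ψ) :
    Nonempty (DirColimitOfSplitEpis S X Y ψ) := by
  classical
  have hcol := PresentedAct.isColimitCone (S := S) (Y := Y)
  have hsys := PresentedAct.isDirectSystem (S := S) (Y := Y)
  let act (R : Finset (ActRelation S Y)) :
      MulAction Sᵐᵒᵖ (ψ.Pullback (PresentedAct.toAct R)) := pullbackAct hmap (hcol.1 R)
  refine ⟨{
    I := Finset (ActRelation S Y)
    directed := inferInstance
    Xs := fun R => ψ.Pullback (PresentedAct.toAct R)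
    Ys := fun R => PresentedAct R
    θ := fun R R' h p => ⟨(p.1.1, PresentedAct.map h p.1.2), p.2.trans (hcol.2.1 R R' h _).symm⟩
    φ := fun _ _ h => PresentedAct.map h
    sysX := ⟨fun R R' h u p => Subtype.ext (Prod.ext rfl (hsys.1 R R' h u p.1.2)),
      fun R p => Subtype.ext (Prod.ext rfl (hsys.2.1 R p.1.2)),
      fun R R' Q h h' p => Subtype.ext (Prod.ext rfl (hsys.2.2 R R' Q h h' p.1.2))⟩
    sysY := hsys
    β := fun _ p => p.1.1
    α := PresentedAct.toAct
    colimX := ⟨fun _ _ _ => rfl, fun _ _ _ _ => rfl, fun x => ?_, fun R R' p q => ⟨fun e => ?_, ?_⟩⟩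
    colimY := hcol
    ψi := fun _ p => p.1.2
    ψi_sMap := fun _ _ _ => rfl
    ψi_split := fun R => ?_
    square := fun _ _ _ _ => rfl
    compat := fun _ p => p.2 }⟩
  · obtain ⟨R, a, ha⟩ := hcol.2.2.1 (ψ x)
    exact ⟨R, ⟨(x, a), ha.symm⟩, rfl⟩
  · obtain ⟨Q, h, h', e'⟩ := (hcol.2.2.2 R R' p.1.2 q.1.2).1
      (p.2.symm.trans ((congrArg ψ e).trans q.2))
    exact ⟨Q, h, h', Subtype.ext (Prod.ext e e')⟩
  · rintro ⟨Q, h, h', e⟩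
    exact congrArg (fun r => r.1.1) e
  · obtain ⟨g, hg, hrel⟩ := hψ.exists_section R
    refine ⟨fun a => ⟨(PresentedAct.desc g hrel a, a), ?_⟩, fun u a =>
      Subtype.ext (Prod.ext (PresentedAct.isSMap_desc g hrel u a) rfl), fun _ => rfl⟩
    induction a using PresentedAct.ind with | h y s
    simp only [PresentedAct.desc_mk, PresentedAct.toAct_mk, hmap s, hg]

/-- A surjective `S`-map is a pure epimorphism if and only if it is a
directed colimit of split epimorphisms. -/
theorem isPureEpi_iff_dirColimitOfSplitEpis {X Y : Type u}
    [MulAction Sᵐᵒᵖ X] [MulAction Sᵐᵒᵖ Y] (ψ : X → Y)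
    (hψmap : IsSMap S ψ) (hψsurj : Surjective ψ) :
    IsPureEpi S ψ ↔ Nonempty (DirColimitOfSplitEpis S X Y ψ) :=
  ⟨fun h => h.nonempty_dirColimitOfSplitEpis S hψmap, fun ⟨D⟩ => D.isPureEpi S hψsurj⟩
end

section
/- Let S be a monoid and let ψ : X → Y be a surjective S-map between right S-acts, where X satisfies condition (E). Then Y satisfies condition (E) if and only if ψ is 1-pure. -/
open MulOpposite Function

universe u v

variable (S : Type u) [Monoid S]

/-- A right `S`-act `A` satisfies condition (E). -/
def CondE (A : Type v) [MulAction Sᵐᵒᵖ A] : Prop :=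
  ∀ (a : A) (u u' : S), op u • a = op u' • a →
    ∃ (a'' : A) (s : S), a = op s • a'' ∧ s * u = s * u'

/-- An `S`-map `ψ : X → Y` is `1`-pure: any single element of `Y` together with finitely
many relations on it lifts, with the relations. -/
def Is1Pure {X Y : Type*} [MulAction Sᵐᵒᵖ X] [MulAction Sᵐᵒᵖ Y] (ψ : X → Y) : Prop :=
  ∀ (y : Y) (m : ℕ) (s t : Fin m → S), (∀ i, op (s i) • y = op (t i) • y) →
    ∃ x : X, ψ x = y ∧ ∀ i, op (s i) • x = op (t i) • x

/-- In an act satisfying condition (E), finitely many relations on one element are witnessed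
simultaneously. -/
theorem CondE.exists_forall_mul_eq {A : Type v} [MulAction Sᵐᵒᵖ A] (hA : CondE S A) (a : A)
    (m : ℕ) (s t : Fin m → S) (h : ∀ i, op (s i) • a = op (t i) • a) :
    ∃ (b : A) (w : S), a = op w • b ∧ ∀ i, w * s i = w * t i := by
  induction m with
  | zero => exact ⟨a, 1, by simp, fun i => i.elim0⟩
  | succ n ih =>
    obtain ⟨b, w, rfl, hw⟩ := ih (fun i => s i.castSucc) (fun i => t i.castSucc)
      (fun i => h i.castSucc)
    have hlast := h (Fin.last n)
    rw [← mul_smul, ← mul_smul, ← op_mul, ← op_mul] at hlast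
    obtain ⟨c, r, rfl, hr⟩ := hA b _ _ hlast
    refine ⟨c, r * w, by rw [op_mul, mul_smul], fun i => ?_⟩
    induction i using Fin.lastCases with
    | last => rw [mul_assoc, mul_assoc, hr]
    | cast i => rw [mul_assoc, mul_assoc, hw i]

/-- If `ψ : X → Y` is a surjective `S`-map and `X` satisfies condition
(E), then `Y` satisfies condition (E) if and only if `ψ` is `1`-pure. -/
theorem condE_iff_is1Pure {X Y : Type u} [MulAction Sᵐᵒᵖ X] [MulAction Sᵐᵒᵖ Y]
    (ψ : X → Y) (hψmap : IsSMap S ψ) (hψsurj : Surjective ψ) (hX : CondE S X) :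
    CondE S Y ↔ Is1Pure S ψ := by
  constructor
  · intro hY y m s t h
    obtain ⟨z, w, rfl, hw⟩ := hY.exists_forall_mul_eq S y m s t h
    obtain ⟨x, rfl⟩ := hψsurj z
    refine ⟨op w • x, hψmap w x, fun i => ?_⟩
    rw [← mul_smul, ← mul_smul, ← op_mul, ← op_mul, hw i]
  · intro hψ y u u' h
    obtain ⟨x, rfl, hx⟩ := hψ y 1 (fun _ => u) (fun _ => u') (fun _ => h)
    obtain ⟨x', s, rfl, hs⟩ := hX x u u' (hx 0)
    exact ⟨ψ x', s, hψmap s x', hs⟩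
end

section
/- Let S be a monoid and let ψ : X → Y be a surjective S-map between right S-acts, where X satisfies condition (P). If ψ is 2-pure then Y satisfies condition (P). -/
open MulOpposite Function

universe u v

variable (S : Type u) [Monoid S]

/-- An `S`-map `ψ : X → Y` is `2`-pure: any pair of elements of `Y` together with
finitely many relations between them lifts, with the relations. -/
def Is2Pure {X Y : Type*} [MulAction Sᵐᵒᵖ X] [MulAction Sᵐᵒᵖ Y] (ψ : X → Y) : Prop :=
  ∀ (a : Fin 2 → Y) (m : ℕ) (α β : Fin m → Fin 2) (s t : Fin m → S),
    (∀ i, op (s i) • a (α i) = op (t i) • a (β i)) →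
    ∃ b : Fin 2 → X, (∀ r, ψ (b r) = a r) ∧
      ∀ i, op (s i) • b (α i) = op (t i) • b (β i)

/-- If `ψ : X → Y` is a surjective `2`-pure `S`-map and `X` satisfies
condition (P), then `Y` satisfies condition (P). -/
theorem condP_of_is2Pure {X Y : Type u} [MulAction Sᵐᵒᵖ X] [MulAction Sᵐᵒᵖ Y]
    (ψ : X → Y) (hψmap : IsSMap S ψ) (hψsurj : Surjective ψ) (hX : CondP S X)
    (hpure : Is2Pure S ψ) : CondP S Y := by
  intro a a' u u' h
  obtain ⟨b, hb, hrel⟩ := hpure ![a, a'] 1 (fun _ ↦ 0) (fun _ ↦ 1) (fun _ ↦ u) (fun _ ↦ u')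
    (fun _ ↦ h)
  obtain ⟨c, s, s', hs, hs', hu⟩ := hX (b 0) (b 1) u u' (hrel 0)
  refine ⟨ψ c, s, s', ?_, ?_, hu⟩
  · rw [← hψmap, ← hs]
    exact (hb 0).symm
  · rw [← hψmap, ← hs']
    exact (hb 1).symm
end

section
/- Let S be a monoid and let 𝒳 be a class of right S-acts which contains a generator G, i.e. some G ∈ 𝒳 admitting a surjective S-map G → S, where S is regarded as a right S-act over itself by right multiplication. If g : C → A is an 𝒳-precover of a right S-act A, then g is surjective. -/
open MulOpposite Function

universe u v

variable (S : Type u) [Monoid S]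

/-- `g : C → A` is an `𝒳`-precover of the right `S`-act `A`: `C ∈ 𝒳`, `g` is an
`S`-map, and every `S`-map from a member of `𝒳` to `A` factors through `g`. -/
def IsPrecover (𝒳 : ∀ (A : Type u) [MulAction Sᵐᵒᵖ A], Prop) {C A : Type u}
    [MulAction Sᵐᵒᵖ C] [MulAction Sᵐᵒᵖ A] (g : C → A) : Prop :=
  𝒳 C ∧ IsSMap S g ∧
    ∀ (C' : Type u) [MulAction Sᵐᵒᵖ C'], 𝒳 C' → ∀ g' : C' → A, IsSMap S g' →
      ∃ f : C' → C, IsSMap S f ∧ ∀ c, g (f c) = g' c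

/-- `g : C → A` is an `𝒳`-cover: an `𝒳`-precover such that every `S`-map `f : C → C`
with `g ∘ f = g` is an isomorphism (i.e. bijective). -/
def IsCover (𝒳 : ∀ (A : Type u) [MulAction Sᵐᵒᵖ A], Prop) {C A : Type u}
    [MulAction Sᵐᵒᵖ C] [MulAction Sᵐᵒᵖ A] (g : C → A) : Prop :=
  IsPrecover S 𝒳 g ∧
    ∀ f : C → C, IsSMap S f → (∀ c, g (f c) = g c) → Bijective f

/-- The class `𝒳` is closed under isomorphisms of right `S`-acts. -/
def ClosedUnderIso (𝒳 : ∀ (A : Type u) [MulAction Sᵐᵒᵖ A], Prop) : Prop :=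
  ∀ (A B : Type u) [MulAction Sᵐᵒᵖ A] [MulAction Sᵐᵒᵖ B] (e : A → B),
    IsSMap S e → Bijective e → 𝒳 A → 𝒳 B

/-- If the class `𝒳` contains a generator `G` (an act in `𝒳`
admitting a surjective `S`-map onto `S`, regarded as a right `S`-act over itself), then
every `𝒳`-precover is surjective. -/
theorem surjective_of_isPrecover_of_generator
    (𝒳 : ∀ (A : Type u) [MulAction Sᵐᵒᵖ A], Prop) (hiso : ClosedUnderIso S 𝒳)
    (G : Type u) [MulAction Sᵐᵒᵖ G] (hG : 𝒳 G)
    (π : G → S) (hπmap : IsSMap S π) (hπsurj : Surjective π)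
    {C A : Type u} [MulAction Sᵐᵒᵖ C] [MulAction Sᵐᵒᵖ A] (g : C → A)
    (hg : IsPrecover S 𝒳 g) : Surjective g := by
  intro a
  obtain ⟨x, hx⟩ := hπsurj 1
  obtain ⟨f, -, hf⟩ := hg.2.2 G hG (fun y => op (π y) • a) fun s y => by
    beta_reduce
    rw [hπmap s y, op_smul_eq_mul, op_mul, mul_smul]
  exact ⟨f x, by rw [hf, hx, op_one, one_smul]⟩
end

section
/- Let S be a monoid, let A be a right S-act and let 𝒳 be a class of right S-acts closed under isomorphisms and under directed colimits. If A has an 𝒳-precover then A has an 𝒳-cover. -/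
open MulOpposite Function

universe u v

variable (S : Type u) [Monoid S]

/-- The class `𝒳` is closed under directed colimits of right `S`-acts. -/
def ClosedUnderDirColim (𝒳 : ∀ (A : Type u) [MulAction Sᵐᵒᵖ A], Prop) : Prop :=
  ∀ (I : Type u) [Preorder I], IsDirected I (· ≤ ·) →
    ∀ (Xs : I → Type u) [∀ i, MulAction Sᵐᵒᵖ (Xs i)]
      (φ : ∀ i j, i ≤ j → Xs i → Xs j), IsDirectSystem S Xs φ →
    ∀ (X : Type u) [MulAction Sᵐᵒᵖ X] (α : ∀ i, Xs i → X),
      IsColimitCone S Xs φ X α → (∀ i, 𝒳 (Xs i)) → 𝒳 X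

theorem IsSMap.comp {A B C : Type*} [MulAction Sᵐᵒᵖ A] [MulAction Sᵐᵒᵖ B] [MulAction Sᵐᵒᵖ C]
    {f : B → C} {g : A → B} (hf : IsSMap S f) (hg : IsSMap S g) : IsSMap S (f ∘ g) := fun s a => by
  simp only [comp_apply, hg s a, hf s (g a)]

/-- The monoid of endomorphisms of a right `S`-act `C` lying over a map `g : C → A`. -/
def endOver {C A : Type*} [MulAction Sᵐᵒᵖ C] (g : C → A) : Submonoid (Function.End C) where
  carrier := {f | IsSMap S f ∧ ∀ c, g (f c) = g c}
  one_mem' := ⟨fun _ _ => rfl, fun _ => rfl⟩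
  mul_mem' {_ b} ha hb := ⟨IsSMap.comp S ha.1 hb.1, fun c => (ha.2 (b c)).trans (hb.2 c)⟩

section Colimit

variable {J : Type u} [Preorder J] {C : Type u}

/-- The eventual-equality relation of a directed diagram all of whose objects are `C`. -/
def colimitSetoid (hJ : IsDirected J (· ≤ ·)) (φ : J → J → C → C)
    (hφ : ∀ i j k, i ≤ j → j ≤ k → ∀ x, φ j k (φ i j x) = φ i k x) : Setoid (J × C) where
  r p q := ∃ k, p.1 ≤ k ∧ q.1 ≤ k ∧ φ p.1 k p.2 = φ q.1 k q.2
  iseqv := by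
    refine ⟨fun p => ⟨p.1, le_rfl, le_rfl, rfl⟩, ?_, ?_⟩
    · rintro p q ⟨k, h₁, h₂, h⟩
      exact ⟨k, h₂, h₁, h.symm⟩
    · rintro p q r ⟨k, h₁, h₂, h⟩ ⟨l, h₃, h₄, h'⟩
      obtain ⟨m, hk, hl⟩ := directed_of (· ≤ ·) k l
      refine ⟨m, h₁.trans hk, h₄.trans hl, ?_⟩
      rw [← hφ _ _ _ h₁ hk, h, hφ _ _ _ h₂ hk, ← hφ _ _ _ h₃ hl, h', hφ _ _ _ h₄ hl]

/-- A directed diagram of endomorphisms of `C` over `A` has a directed colimit over `A`. -/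
theorem exists_colimitCone_endOver {A : Type u} [MulAction Sᵐᵒᵖ C] [MulAction Sᵐᵒᵖ A]
    (g : C → A) (hg : IsSMap S g) (hJ : IsDirected J (· ≤ ·)) (φ : J → J → endOver S g)
    (hφ₁ : ∀ i, φ i i = 1) (hφ : ∀ i j k, i ≤ j → j ≤ k → φ j k * φ i j = φ i k) :
    ∃ (L : Type u) (_ : MulAction Sᵐᵒᵖ L) (α : J → C → L) (gL : L → A),
      IsDirectSystem S (fun _ : J => C) (fun i j _ => (φ i j).1) ∧
      IsColimitCone S (fun _ : J => C) (fun i j _ => (φ i j).1) L α ∧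
      IsSMap S gL ∧ ∀ i x, gL (α i x) = g x := by
  have hφ' : ∀ i j k, i ≤ j → j ≤ k → ∀ x, (φ j k).1 ((φ i j).1 x) = (φ i k).1 x :=
    fun i j k hij hjk x => congrFun (congrArg Subtype.val (hφ i j k hij hjk)) x
  have hφ₁' : ∀ i x, (φ i i).1 x = x := fun i x => congrFun (congrArg Subtype.val (hφ₁ i)) x
  let st := colimitSetoid hJ (fun i j => (φ i j).1) hφ'
  let act : MulAction Sᵐᵒᵖ (Quotient st) :=
    { smul := fun s => Quotient.map (fun p => (p.1, s • p.2)) (by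
        rintro p q ⟨k, h₁, h₂, h⟩
        refine ⟨k, h₁, h₂, ?_⟩
        have e₁ := (φ p.1 k).2.1 s.unop p.2
        have e₂ := (φ q.1 k).2.1 s.unop q.2
        exact e₁.trans ((congrArg _ h).trans e₂.symm))
      one_smul := by
        rintro ⟨p⟩
        exact congrArg (Quotient.mk st) (Prod.ext rfl (one_smul _ p.2))
      mul_smul := by
        rintro s t ⟨p⟩
        exact congrArg (Quotient.mk st) (Prod.ext rfl (mul_smul s t p.2)) }
  refine ⟨Quotient st, act, fun i x => Quotient.mk st (i, x),
    Quotient.lift (fun p => g p.2) ?_, ⟨fun i j _ => (φ i j).2.1, hφ₁', fun i j k => hφ' i j k⟩,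
    ⟨fun _ _ _ => rfl, ?_, ?_, ?_⟩, ?_, fun _ _ => rfl⟩
  · rintro p q ⟨k, h₁, h₂, h⟩
    exact ((φ p.1 k).2.2 p.2).symm.trans ((congrArg g h).trans ((φ q.1 k).2.2 q.2))
  · exact fun i j h x => Quotient.sound ⟨j, le_rfl, h, hφ₁' j _⟩
  · rintro ⟨p⟩
    exact ⟨p.1, p.2, rfl⟩
  · intro i j x y
    refine ⟨fun h => ?_, ?_⟩
    · obtain ⟨k, h₁, h₂, h⟩ := Quotient.exact h
      exact ⟨k, h₁, h₂, h⟩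
    · rintro ⟨k, h₁, h₂, h⟩
      exact Quotient.sound ⟨k, h₁, h₂, h⟩
  · rintro s ⟨p⟩
    exact hg s p.2

end Colimit

/-- Every linearly ordered diagram in the monoid `M`, viewed as a one-object category, has a
cocone. -/
def HasChainCocones (M : Type u) [Monoid M] : Prop :=
  ∀ (J : Type u) [LinearOrder J] (φ : J → J → M),
    (∀ i j k, i < j → j < k → φ j k * φ i j = φ i k) → ∃ c : J → M, ∀ i j, i < j → c j * φ i j = c i

/-- Transfinite construction of a diagram in `M`: at each stage a cocone `c` over the earlier
stages is chosen and then modified by `H c`. -/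
theorem HasChainCocones.exists_diagram {M : Type u} [Monoid M] (hM : HasChainCocones M)
    (W : Type u) [LinearOrder W] [WellFoundedLT W] (H : (W → M) → M) :
    ∃ φ : W → W → M, (∀ i j k, i < j → j < k → φ j k * φ i j = φ i k) ∧
      ∀ j, ∃ c : W → M, (∀ i k, i < k → k < j → c k * φ i k = c i) ∧ ∀ i, φ i j = H c * c i := by
  classical
  let step (j : W) (ih : ∀ k, k < j → W → M) : W → M :=
    let c : W → M := if h : ∃ c : W → M, ∀ i k, i < k → ∀ hk : k < j, c k * ih k hk i = c i
      then h.choose else 1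
    fun i => H c * c i
  let F : W → W → M := (wellFounded_lt (α := W)).fix step
  have hF : ∀ j, F j = step j (fun k _ => F k) := fun j => WellFounded.fix_eq _ _ _
  have key : ∀ j, (∀ i k l, i < k → k < l → l < j → F l k * F k i = F l i) →
      ∃ c : W → M, (∀ i k, i < k → k < j → c k * F k i = c i) ∧ ∀ i, F j i = H c * c i := by
    intro j hj
    have h : ∃ c : W → M, ∀ i k, i < k → k < j → c k * F k i = c i := by
      obtain ⟨c, hc⟩ := hM (Set.Iio j) (fun i k => F k i)
        (fun i k l hik hkl => hj i k l hik hkl l.2)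
      refine ⟨fun i => if hi : i < j then c ⟨i, hi⟩ else 1, fun i k hik hkj => ?_⟩
      simpa [hkj, hik.trans hkj] using hc ⟨i, hik.trans hkj⟩ ⟨k, hkj⟩ hik
    refine ⟨h.choose, h.choose_spec, fun i => ?_⟩
    rw [hF]
    simp only [step, dif_pos h]
  have comp : ∀ l i k, i < k → k < l → F l k * F k i = F l i := by
    intro l
    induction l using WellFoundedLT.induction with
    | ind l ih =>
      intro i k hik hkl
      obtain ⟨c, hc, hF'⟩ := key l fun i k m hik hkm hml => ih m hml i k hik hkm
      rw [hF', hF', mul_assoc, hc i k hik hkl]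
  exact ⟨fun i j => F j i, fun i j k => comp k i j, fun j => key j fun i k l hik hkl _ =>
    comp l i k hik hkl⟩

/-- There are well-orders too long to be injected into a given type. -/
theorem exists_wellOrder_forall_collision (X : Type u) :
    ∃ (W : Type u) (_ : LinearOrder W) (_ : WellFoundedLT W),
      ∀ F : W → X, ∃ i j, i < j ∧ F i = F j := by
  have : ∃ W : Type u, ∀ F : W → X, ¬ Injective F := ⟨Set X, cantor_injective⟩
  obtain ⟨W, hW⟩ := this
  obtain ⟨_, _⟩ := exists_wellFoundedLT W
  refine ⟨W, inferInstance, inferInstance, fun F => ?_⟩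
  by_contra! h
  refine hW F fun i j hij => ?_
  rcases lt_trichotomy i j with hlt | rfl | hlt
  · exact (h i j hlt hij).elim
  · rfl
  · exact (h j i hlt hij.symm).elim

section Submonoid

variable {C : Type u} {M : Submonoid (Function.End C)}

/-- Some element of `M` has a kernel that no further composition enlarges. -/
theorem HasChainCocones.exists_maximal_ker (hM : HasChainCocones M) :
    ∃ e : M, ∀ (h : M) (x y : C), h.1 (e.1 x) = h.1 (e.1 y) → e.1 x = e.1 y := by
  by_contra! hne
  choose h hh using hne
  obtain ⟨W, _, _, hW⟩ := exists_wellOrder_forall_collision (Set (C × C))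
  obtain ⟨φ, -, hφ⟩ := hM.exists_diagram (WithBot W) (fun c => h (c ⊥))
  obtain ⟨i, j, hij, heq⟩ := hW fun j => {p : C × C | (φ ⊥ j).1 p.1 = (φ ⊥ j).1 p.2}
  obtain ⟨c, hc, hj⟩ := hφ j
  obtain ⟨x, y, hxy, hne⟩ := hh (c ⊥)
  have hmem : (x, y) ∈ {p : C × C | (φ ⊥ j).1 p.1 = (φ ⊥ j).1 p.2} := by
    simp only [Set.mem_ofPred_eq, hj ⊥]
    exact hxy
  rw [← heq] at hmem
  refine hne ?_
  rw [← hc ⊥ i (WithBot.bot_lt_coe i) (WithBot.coe_lt_coe.2 hij)]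
  exact congrArg (c i).1 hmem

/-- If all elements of `M` are injective, they are all surjective. -/
theorem HasChainCocones.surjective (hM : HasChainCocones M)
    (hinj : ∀ f : M, Injective f.1) (f : M) : Surjective f.1 := by
  intro y
  by_contra hy
  obtain ⟨W, _, _, hW⟩ := exists_wellOrder_forall_collision (Set C)
  obtain ⟨φ, hcomp, hφ⟩ := hM.exists_diagram W (fun _ => f)
  obtain ⟨c, hc⟩ := hM _ φ hcomp
  obtain ⟨i, j, hij, heq⟩ := hW fun j => Set.range (c j).1
  refine hy ?_
  obtain ⟨x, hx⟩ : (c j).1 y ∈ Set.range (c i).1 := by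
    rw [heq]
    exact ⟨y, rfl⟩
  obtain ⟨d, -, hd⟩ := hφ j
  rw [← hc i j hij, hd i] at hx
  exact ⟨(d i).1 x, hinj (c j) hx⟩

end Submonoid

theorem IsPrecover.hasChainCocones {𝒳 : ∀ (B : Type u) [MulAction Sᵐᵒᵖ B], Prop}
    (hdc : ClosedUnderDirColim S 𝒳) {C A : Type u} [MulAction Sᵐᵒᵖ C] [MulAction Sᵐᵒᵖ A]
    {g : C → A} (hg : IsPrecover S 𝒳 g) : HasChainCocones (endOver S g) := by
  intro J _ φ hφ
  classical
  obtain ⟨L, _, α, gL, hsys, hcone, hgL, hα⟩ := exists_colimitCone_endOver S g hg.2.1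
    (J := J) inferInstance (fun i j => if i = j then 1 else φ i j) (fun i => if_pos rfl) (by
      intro i j k hij hjk
      rcases hij.eq_or_lt with rfl | hij
      · simp
      rcases hjk.eq_or_lt with rfl | hjk
      · simp
      simpa [hij.ne, hjk.ne, (hij.trans hjk).ne] using hφ i j k hij hjk)
  obtain ⟨r, hr, hgr⟩ := hg.2.2 L (hdc J inferInstance _ _ hsys L α hcone fun _ => hg.1) gL hgL
  refine ⟨fun i => ⟨r ∘ α i, IsSMap.comp S hr (hcone.1 i), fun x => (hgr _).trans (hα i x)⟩,
    fun i j hij => Subtype.ext (funext fun x => ?_)⟩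
  have h := hcone.2.1 i j hij.le x
  simp only [hij.ne, if_false] at h
  exact congrArg r h

/-- A precover all of whose endomorphisms are injective exists as soon as some precover does. -/
theorem IsPrecover.exists_injective {𝒳 : ∀ (B : Type u) [MulAction Sᵐᵒᵖ B], Prop}
    (hdc : ClosedUnderDirColim S 𝒳) {C A : Type u} [MulAction Sᵐᵒᵖ C] [MulAction Sᵐᵒᵖ A]
    {g : C → A} (hg : IsPrecover S 𝒳 g) :
    ∃ (L : Type u) (_ : MulAction Sᵐᵒᵖ L) (gL : L → A),
      IsPrecover S 𝒳 gL ∧ ∀ f : endOver S gL, Injective f.1 := by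
  obtain ⟨e, he⟩ := (hg.hasChainCocones S hdc).exists_maximal_ker
  obtain ⟨L, _, α, gL, hsys, hcone, hgL, hα⟩ := exists_colimitCone_endOver S g hg.2.1
    (J := ULift.{u} ℕ) inferInstance (fun i j => e ^ (j.down - i.down)) (fun i => by simp) (by
      intro i j k hij hjk
      have h₁ : i.down ≤ j.down := hij
      have h₂ : j.down ≤ k.down := hjk
      rw [← pow_add]
      congr 1
      omega)
  have hL : 𝒳 L := hdc _ inferInstance _ _ hsys L α hcone fun _ => hg.1
  have hsucc : ∀ n : ULift.{u} ℕ, ∀ x, α n x = α ⟨n.down + 1⟩ (e.1 x) := fun n x => by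
    have h := hcone.2.1 n ⟨n.down + 1⟩ (Nat.le_succ n.down) x
    simp only [add_tsub_cancel_left, pow_one] at h
    exact h.symm
  refine ⟨L, inferInstance, gL, ⟨hL, hgL, fun C' _ hC' g' hg' => ?_⟩, fun f x y hxy => ?_⟩
  · obtain ⟨k, hk, hgk⟩ := hg.2.2 C' hC' g' hg'
    exact ⟨α ⟨0⟩ ∘ k, IsSMap.comp S (hcone.1 _) hk, fun c => (hα _ _).trans (hgk c)⟩
  · obtain ⟨r, hr, hgr⟩ := hg.2.2 L hL gL hgL
    obtain ⟨n, x, y, rfl, rfl⟩ : ∃ n x' y', α n x' = x ∧ α n y' = y := by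
      obtain ⟨i, x, rfl⟩ := hcone.2.2.1 x
      obtain ⟨j, y, rfl⟩ := hcone.2.2.1 y
      obtain ⟨k, hi, hj⟩ := directed_of (· ≤ ·) i j
      exact ⟨k, _, _, hcone.2.1 i k hi x, hcone.2.1 j k hj y⟩
    rw [hsucc n x, hsucc n y] at hxy ⊢
    let h : endOver S g := ⟨r ∘ f.1 ∘ α ⟨n.down + 1⟩,
      IsSMap.comp S hr (IsSMap.comp S f.2.1 (hcone.1 _)),
      fun c => (hgr _).trans ((f.2.2 _).trans (hα _ c))⟩
    exact congrArg _ (he h x y (congrArg r hxy))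

/-- If `𝒳` is a class of right `S`-acts closed under isomorphisms and
directed colimits, then any right `S`-act admitting an `𝒳`-precover admits an
`𝒳`-cover. -/
theorem exists_cover_of_exists_precover
    (𝒳 : ∀ (B : Type u) [MulAction Sᵐᵒᵖ B], Prop)
    (hiso : ClosedUnderIso S 𝒳) (hdc : ClosedUnderDirColim S 𝒳)
    (A : Type u) [MulAction Sᵐᵒᵖ A]
    (hpre : ∃ (C : Type u) (instC : MulAction Sᵐᵒᵖ C) (g : C → A),
      @IsPrecover S _ 𝒳 C A instC _ g) :
    ∃ (C : Type u) (instC : MulAction Sᵐᵒᵖ C) (g : C → A),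
      @IsCover S _ 𝒳 C A instC _ g := by
  obtain ⟨C, _, g, hg⟩ := hpre
  obtain ⟨L, _, gL, hgL, hinj⟩ := hg.exists_injective S hdc
  exact ⟨L, inferInstance, gL, hgL, fun f hf hgf => ⟨hinj ⟨f, hf, hgf⟩,
    (hgL.hasChainCocones S hdc).surjective hinj ⟨f, hf, hgf⟩⟩⟩
end

section
/- Let S be a monoid and let X be a right S-act satisfying condition (P). Suppose n ≥ 2, x_1, …, x_n ∈ X and s_1, …, s_{n-1}, t_2, …, t_n ∈ S satisfy the system of equations x_i•s_i = x_{i+1}•t_{i+1} for all 1 ≤ i ≤ n−1. Then there exist y ∈ X and u_1, …, u_n ∈ S such that x_i = y•u_i for all 1 ≤ i ≤ n and u_i*s_i = u_{i+1}*t_{i+1} for all 1 ≤ i ≤ n−1. -/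
open MulOpposite Function

universe u v

variable (S : Type u) [Monoid S]

/-- The chain of equations, for any length `n ≥ 1`. -/
theorem CondP.exists_common_factor {X : Type v} [MulAction Sᵐᵒᵖ X] (hX : CondP S X)
    (x : ℕ → X) (s t : ℕ → S) (n : ℕ) (hn : 1 ≤ n)
    (hsys : ∀ i, 1 ≤ i → i + 1 ≤ n → op (s i) • x i = op (t (i + 1)) • x (i + 1)) :
    ∃ (y : X) (u : ℕ → S), (∀ i, 1 ≤ i → i ≤ n → x i = op (u i) • y) ∧
      ∀ i, 1 ≤ i → i + 1 ≤ n → u i * s i = u (i + 1) * t (i + 1) := by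
  induction n, hn using Nat.le_induction with
  | base => exact ⟨x 1, fun _ => 1, fun i h1 h2 => by simp [le_antisymm h2 h1], by lia⟩
  | succ n hn ih =>
    obtain ⟨y, u, hu, hus⟩ := ih fun i h1 h2 => hsys i h1 (by lia)
    have h := hsys n hn le_rfl
    rw [hu n hn le_rfl, smul_smul, ← op_mul] at h
    obtain ⟨z, p, q, hy, hq, hpq⟩ := hX _ _ _ _ h
    refine ⟨z, fun i => if i = n + 1 then q else p * u i, fun i h1 h2 => ?_, fun i h1 h2 => ?_⟩
    · obtain rfl | hi := eq_or_ne i (n + 1)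
      · simpa using hq
      · rw [hu i h1 (by lia), hy]
        simp [hi, smul_smul]
    · obtain rfl | hi := eq_or_ne i n
      · simpa [mul_assoc] using hpq
      · simp [show i ≠ n + 1 by lia, hi, mul_assoc, hus i h1 (by lia)]

/-- In a right `S`-act satisfying condition (P), a chain of equations
`xᵢ • sᵢ = xᵢ₊₁ • tᵢ₊₁` (`1 ≤ i ≤ n - 1`) can be solved: there are `y` and `u₁, …, uₙ`
with `xᵢ = y • uᵢ` (`1 ≤ i ≤ n`) and `uᵢ * sᵢ = uᵢ₊₁ * tᵢ₊₁` (`1 ≤ i ≤ n - 1`). -/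
theorem condP_system_of_equations {X : Type u} [MulAction Sᵐᵒᵖ X] (hX : CondP S X)
    (n : ℕ) (hn : 2 ≤ n) (x : ℕ → X) (s t : ℕ → S)
    (hsys : ∀ i, 1 ≤ i → i + 1 ≤ n → op (s i) • x i = op (t (i + 1)) • x (i + 1)) :
    ∃ (y : X) (u : ℕ → S), (∀ i, 1 ≤ i → i ≤ n → x i = op (u i) • y) ∧
      ∀ i, 1 ≤ i → i + 1 ≤ n → u i * s i = u (i + 1) * t (i + 1) := by
  exact hX.exists_common_factor S x s t n (by lia) hsys
end

section
/- Let S be a monoid with the following property: for every s ∈ S there exists k ∈ ℕ such that for every m ∈ S the set {p ∈ S : p*s = m} has at most k elements. Then every right S-act has an 𝒮ℱ-cover and a 𝒞𝒫-cover, where 𝒮ℱ is the class of strongly flat right S-acts and 𝒞𝒫 is the class of right S-acts satisfying condition (P). -/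
open MulOpposite Function

universe u v

variable (S : Type u) [Monoid S]

/-- The right `S`-act `A` has an `𝒳`-cover. -/
def HasCover (𝒳 : ∀ (B : Type u) [MulAction Sᵐᵒᵖ B], Prop)
    (A : Type u) [MulAction Sᵐᵒᵖ A] : Prop :=
  ∃ (C : Type u) (instC : MulAction Sᵐᵒᵖ C) (g : C → A), @IsCover S _ 𝒳 C A instC _ g

section CoverConstruction

variable {S}

lemma CondP.exists_common_factor_s18 {Y : Type v} [MulAction Sᵐᵒᵖ Y] (hP : CondP S Y) (s : S) (x : Y)
    (F : Finset Y) (hne : F.Nonempty) (hF : ∀ z ∈ F, op s • z = x) :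
    ∃ (c : Y) (a : Y → S) (m : S), ∀ z ∈ F, z = op (a z) • c ∧ a z * s = m := by
  classical
  induction hne using Finset.Nonempty.cons_induction with
  | singleton z => exact ⟨z, fun _ => 1, s, by simp⟩
  | cons z F hz hne ih =>
    obtain ⟨c, a, m, h⟩ := ih fun w hw => hF w (Finset.mem_cons_of_mem hw)
    obtain ⟨w, hw⟩ := hne
    have key : op s • z = op m • c := by
      rw [hF z (Finset.mem_cons_self _ _), ← hF w (Finset.mem_cons_of_mem hw), ← (h w hw).2,
        op_mul, mul_smul, ← (h w hw).1]
    obtain ⟨d, b, q, hb, hq, hbq⟩ := hP _ _ _ _ key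
    refine ⟨d, fun v => if v = z then b else q * a v, q * m, fun v hv => ?_⟩
    rcases Finset.mem_cons.1 hv with rfl | hv
    · simp [hb.symm, hbq]
    · have hvz : v ≠ z := fun h => hz (h ▸ hv)
      simp only [hvz, if_false]
      refine ⟨?_, by rw [mul_assoc, (h v hv).2]⟩
      rw [op_mul, mul_smul, ← hq]
      exact (h v hv).1

lemma CondP.finite_fiber {Y : Type v} [MulAction Sᵐᵒᵖ Y] (hP : CondP S Y)
    (hS : ∀ s : S, ∃ k : ℕ, ∀ m : S,
      {p : S | p * s = m}.Finite ∧ {p : S | p * s = m}.ncard ≤ k) (s : S) (x : Y) :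
    {z : Y | op s • z = x}.Finite := by
  by_contra hinf
  obtain ⟨k, hk⟩ := hS s
  obtain ⟨F, hF, hcard⟩ := Set.Infinite.exists_subset_card_eq hinf (k + 1)
  have hne : F.Nonempty := by rw [← Finset.card_pos]; omega
  obtain ⟨c, a, m, h⟩ := hP.exists_common_factor_s18 s x F hne fun z hz => hF hz
  have h1 : (F : Set Y).ncard ≤ {p : S | p * s = m}.ncard :=
    Set.ncard_le_ncard_of_injOn a (fun z hz => (h z hz).2)
      (fun z hz w hw hzw => by rw [(h z hz).1, (h w hw).1, hzw]) (hk m).1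
  rw [Set.ncard_coe_finset, hcard] at h1
  have := (hk m).2
  omega

variable (S) in
/-- Right `S`-acts over `A` satisfying condition (P) (and condition (E) when `e` holds) in which
any two elements lie in a common cyclic subact. -/
structure LocallyCyclicOver (A : Type u) [MulAction Sᵐᵒᵖ A] (e : Prop) where
  /-- The underlying type. -/
  X : Type u
  [inst : MulAction Sᵐᵒᵖ X]
  /-- The structure map. -/
  g : X → A
  map_g : IsSMap S g
  nonempty : Nonempty X
  directed : ∀ x y : X, ∃ (z : X) (s t : S), x = op s • z ∧ y = op t • z
  condP : CondP S X
  condE : e → CondE S X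

attribute [instance] LocallyCyclicOver.inst

namespace LocallyCyclicOver

variable {A : Type u} [MulAction Sᵐᵒᵖ A] {e : Prop}

/-- `S`-maps over `A`. -/
def IsHom (Y Z : LocallyCyclicOver S A e) (f : Y.X → Z.X) : Prop :=
  IsSMap S f ∧ ∀ y, Z.g (f y) = Y.g y

lemma IsHom.comp {X Y Z : LocallyCyclicOver S A e} {f : Y.X → Z.X} {h : X.X → Y.X}
    (hf : IsHom Y Z f) (hh : IsHom X Y h) : IsHom X Z (f ∘ h) :=
  ⟨fun s x => (congrArg f (hh.1 s x)).trans (hf.1 s _), fun x => (hf.2 _).trans (hh.2 x)⟩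

lemma IsHom.exists_inverse {Y Z : LocallyCyclicOver S A e} {f : Y.X → Z.X} (hf : IsHom Y Z f)
    (hb : Bijective f) : ∃ h : Z.X → Y.X, IsHom Z Y h ∧ Bijective h := by
  obtain ⟨h, hl, hr⟩ := bijective_iff_has_inverse.1 hb
  refine ⟨h, ⟨fun s z => hb.1 ?_, fun z => ?_⟩, hr.injective, hl.surjective⟩
  · rw [hr, hf.1, hr]
  · rw [← hf.2, hr]

/-- Every map out of `Y` is injective. -/
def MonoSat (Y : LocallyCyclicOver S A e) : Prop :=
  ∀ (Z : LocallyCyclicOver S A e) (f : Y.X → Z.X), IsHom Y Z f → Injective f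

/-- `Y` is maximal among the objects all of whose outgoing maps are injective. -/
def IsMaximal (Y : LocallyCyclicOver S A e) : Prop :=
  MonoSat Y ∧ ∀ (Z : LocallyCyclicOver S A e) (f : Y.X → Z.X), MonoSat Z → IsHom Y Z f →
    Bijective f

lemma MonoSat.of_hom {Y Z : LocallyCyclicOver S A e} {f : Y.X → Z.X} (hY : MonoSat Y)
    (hf : IsHom Y Z f) (hb : Bijective f) : MonoSat Z := by
  intro W h hh a b hab
  obtain ⟨a, rfl⟩ := hb.2 a
  obtain ⟨b, rfl⟩ := hb.2 b
  rw [hY W (h ∘ f) (hh.comp hf) hab]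

lemma IsMaximal.of_hom {Y Z : LocallyCyclicOver S A e} {f : Y.X → Z.X} (hY : IsMaximal Y)
    (hf : IsHom Y Z f) (hb : Bijective f) : IsMaximal Z :=
  ⟨hY.1.of_hom hf hb, fun W h hW hh => hb.of_comp_iff h |>.1 (hY.2 W _ hW (hh.comp hf))⟩

lemma exists_injective (hS : ∀ s : S, ∃ k : ℕ, ∀ m : S,
      {p : S | p * s = m}.Finite ∧ {p : S | p * s = m}.ncard ≤ k)
    (Y : LocallyCyclicOver S A e) : ∃ f : Y.X → S × ℕ × S, Injective f := by
  obtain ⟨x⟩ := Y.nonempty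
  choose z s t hx hy using Y.directed x
  have hfin (s : S) : ∃ n : {z : Y.X | op s • z = x} → ℕ, Injective n :=
    have := (Y.condP.finite_fiber hS s x).to_subtype
    exists_injective_nat _
  choose n hn using hfin
  refine ⟨fun y => (s y, n (s y) ⟨z y, (hx y).symm⟩, t y), fun a b hab => ?_⟩
  simp only [Prod.mk.injEq] at hab
  obtain ⟨h1, h2, h3⟩ := hab
  have key : ∀ s' (hs : s' = s b) (w : Y.X) (hw : op s' • w = x),
      n s' ⟨w, hw⟩ = n (s b) ⟨z b, (hx b).symm⟩ → w = z b := by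
    rintro _ rfl w hw h
    exact congrArg Subtype.val (hn _ h)
  rw [hy a, hy b, key _ h1 _ _ h2, h3]

variable (S A) in
/-- Candidate presentations with labels in `U`: the relations `[x] • s = [y]` and `g [x] = a`. -/
abbrev Rels (U : Type u) : Type u := (S → U → U → Prop) × (U → A → Prop)

/-- The relations `R` describe the locally cyclic act `Y`, an element `x` of the set `D` of labels
being a name for `π x`. -/
structure Presents {U : Type u} (R : Rels S A U) (Y : LocallyCyclicOver S A e) (D : Set U)
    (π : U → Y.X) : Prop where
  surj : ∀ y, ∃ x ∈ D, π x = y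
  act : ∀ s x y, R.1 s x y ↔ x ∈ D ∧ y ∈ D ∧ op s • π x = π y
  lab : ∀ x a, R.2 x a ↔ x ∈ D ∧ Y.g (π x) = a

/-- The conditions for `R` to present some locally cyclic act. -/
structure IsPres {U : Type u} (e : Prop) (R : Rels S A U) : Prop where
  nonempty : ∃ x, R.1 1 x x
  left : ∀ s x y, R.1 s x y → R.1 1 x x
  right : ∀ s x y, R.1 s x y → R.1 1 y y
  symm : ∀ x y, R.1 1 x y → R.1 1 y x
  total : ∀ s x, R.1 1 x x → ∃ y, R.1 s x y
  unique : ∀ s x y y', R.1 s x y → R.1 s x y' → R.1 1 y y'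
  comp : ∀ s t x y z, R.1 s x y → R.1 t y z → R.1 (s * t) x z
  lab_dom : ∀ x a, R.2 x a → R.1 1 x x
  lab_total : ∀ x, R.1 1 x x → ∃ a, R.2 x a
  lab_unique : ∀ x a b, R.2 x a → R.2 x b → a = b
  lab_act : ∀ s x y a, R.1 s x y → R.2 x a → R.2 y (op s • a)
  directed : ∀ x y, R.1 1 x x → R.1 1 y y → ∃ z s t, R.1 s z x ∧ R.1 t z y
  condP : ∀ x y z u v, R.1 u x z → R.1 v y z →
    ∃ w s t, R.1 s w x ∧ R.1 t w y ∧ s * u = t * v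
  condE : e → ∀ x z u v, R.1 u x z → R.1 v x z → ∃ w s, R.1 s w x ∧ s * u = s * v

section Presentations

variable {U : Type u} {R R' : Rels S A U} {Y Y' : LocallyCyclicOver S A e} {D D' : Set U}
  {π : U → Y.X} {π' : U → Y'.X}

lemma Presents.mem_iff (h : Presents R Y D π) (x : U) : x ∈ D ↔ R.1 1 x x := by
  simp [h.act]

lemma Presents.eq_iff (h : Presents R Y D π) {x y : U} (hx : x ∈ D) (hy : y ∈ D) :
    R.1 1 x y ↔ π x = π y := by
  simp [h.act, hx, hy]

lemma Presents.isPres (h : Presents R Y D π) : IsPres e R where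
  nonempty := by
    obtain ⟨y⟩ := Y.nonempty
    obtain ⟨x, hx, -⟩ := h.surj y
    exact ⟨x, (h.mem_iff x).1 hx⟩
  left s x y hxy := (h.mem_iff x).1 ((h.act _ _ _).1 hxy).1
  right s x y hxy := (h.mem_iff y).1 ((h.act _ _ _).1 hxy).2.1
  symm x y hxy := by
    simp only [h.act, op_one, one_smul] at *
    exact ⟨hxy.2.1, hxy.1, hxy.2.2.symm⟩
  total s x hx := by
    obtain ⟨y, hy, e⟩ := h.surj (op s • π x)
    exact ⟨y, (h.act _ _ _).2 ⟨(h.mem_iff x).2 hx, hy, e.symm⟩⟩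
  unique s x y y' h1 h2 := by
    simp only [h.act, op_one, one_smul] at *
    exact ⟨h1.2.1, h2.2.1, h1.2.2.symm.trans h2.2.2⟩
  comp s t x y z h1 h2 := by
    simp only [h.act] at *
    exact ⟨h1.1, h2.2.1, by rw [op_mul, mul_smul, h1.2.2, h2.2.2]⟩
  lab_dom x a hx := (h.mem_iff x).1 ((h.lab _ _).1 hx).1
  lab_total x hx := ⟨_, (h.lab _ _).2 ⟨(h.mem_iff x).2 hx, rfl⟩⟩
  lab_unique x a b ha hb := ((h.lab _ _).1 ha).2.symm.trans ((h.lab _ _).1 hb).2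
  lab_act s x y a hxy hx := by
    rw [h.act] at hxy
    rw [h.lab] at *
    exact ⟨hxy.2.1, by rw [← hxy.2.2, Y.map_g, hx.2]⟩
  directed x y hx hy := by
    obtain ⟨z, s, t, h1, h2⟩ := Y.directed (π x) (π y)
    obtain ⟨z, hz, rfl⟩ := h.surj z
    exact ⟨z, s, t, (h.act _ _ _).2 ⟨hz, (h.mem_iff x).2 hx, h1.symm⟩,
      (h.act _ _ _).2 ⟨hz, (h.mem_iff y).2 hy, h2.symm⟩⟩
  condP x y z u v h1 h2 := by
    rw [h.act] at h1 h2
    obtain ⟨w, s, t, hs, ht, hst⟩ := Y.condP (π x) (π y) u v (h1.2.2.trans h2.2.2.symm)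
    obtain ⟨w, hw, rfl⟩ := h.surj w
    exact ⟨w, s, t, (h.act _ _ _).2 ⟨hw, h1.1, hs.symm⟩, (h.act _ _ _).2 ⟨hw, h2.1, ht.symm⟩, hst⟩
  condE he x z u v h1 h2 := by
    rw [h.act] at h1 h2
    obtain ⟨w, s, hs, hst⟩ := Y.condE he (π x) u v (h1.2.2.trans h2.2.2.symm)
    obtain ⟨w, hw, rfl⟩ := h.surj w
    exact ⟨w, s, (h.act _ _ _).2 ⟨hw, h1.1, hs.symm⟩, hst⟩

/-- Equality of the elements named by two labels. -/
def IsPres.setoid (h : IsPres e R) : Setoid {x : U // R.1 1 x x} where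
  r x y := R.1 1 x y
  iseqv := ⟨fun x => x.2, fun hxy => h.symm _ _ hxy,
    fun hxy hyz => by simpa using h.comp _ _ _ _ _ hxy hyz⟩

lemma IsPres.exists_presents (h : IsPres e R) :
    ∃ (Y : LocallyCyclicOver S A e) (D : Set U) (π : U → Y.X), Presents R Y D π := by
  classical
  let Q := Quotient h.setoid
  have hmk : ∀ x y : {x : U // R.1 1 x x},
      (Quotient.mk h.setoid x = Quotient.mk h.setoid y) ↔ R.1 1 x y :=
    fun x y => Quotient.eq (r := h.setoid)
  choose! τ hτ using h.total
  obtain ⟨x₀, hx₀⟩ := h.nonempty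
  have : Nonempty A := ⟨(h.lab_total x₀ hx₀).choose⟩
  choose! l hl using h.lab_total
  let act : S → Q → Q := fun s => Quotient.lift
    (fun x => Quotient.mk h.setoid ⟨τ s x, h.right _ _ _ (hτ s x x.2)⟩) (by
      intro x y hxy
      refine (hmk _ _).2 (h.unique s x _ _ (hτ s x x.2) ?_)
      simpa using h.comp _ _ _ _ _ hxy (hτ s y y.2))
  have act_mk : ∀ s (x y : {x : U // R.1 1 x x}),
      act s (Quotient.mk h.setoid x) = Quotient.mk h.setoid y ↔ R.1 s x y := by
    intro s x y
    refine (hmk _ _).trans ⟨fun H => ?_, fun H => h.unique s x _ _ (hτ s x x.2) H⟩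
    simpa using h.comp _ _ _ _ _ (hτ s x x.2) H
  let _ : MulAction Sᵐᵒᵖ Q :=
    { smul := fun s q => act s.unop q
      one_smul := by
        intro q
        induction q using Quotient.ind with | _ x => exact (act_mk _ _ _).2 x.2
      mul_smul := by
        intro s t q
        induction q using Quotient.ind with | _ x =>
        obtain ⟨y, hy⟩ := Quotient.exists_rep (act t.unop (Quotient.mk h.setoid x))
        obtain ⟨z, hz⟩ := Quotient.exists_rep (act s.unop (Quotient.mk h.setoid y))
        change act (s * t).unop _ = act s.unop (act t.unop _)
        rw [← hy, ← hz, act_mk, unop_mul]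
        exact h.comp _ _ _ _ _ ((act_mk _ _ _).1 hy.symm) ((act_mk _ _ _).1 hz.symm) }
  have smul_mk : ∀ s (x y : {x : U // R.1 1 x x}),
      op s • (Quotient.mk h.setoid x) = Quotient.mk h.setoid y ↔ R.1 s x y := act_mk
  let g : Q → A := Quotient.lift (fun x => l x) (by
    intro x y hxy
    refine h.lab_unique y _ _ ?_ (hl y y.2)
    simpa using h.lab_act _ _ _ _ hxy (hl x x.2))
  let Y : LocallyCyclicOver S A e :=
    { X := Q
      g := g
      map_g := by
        intro s q
        induction q using Quotient.ind with | _ x =>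
        obtain ⟨y, hy⟩ := Quotient.exists_rep (op s • (Quotient.mk h.setoid x))
        rw [← hy]
        exact h.lab_unique y _ _ (hl y y.2)
          (h.lab_act _ _ _ _ ((smul_mk _ _ _).1 hy.symm) (hl x x.2))
      nonempty := ⟨Quotient.mk _ ⟨x₀, hx₀⟩⟩
      directed := by
        intro a b
        induction a using Quotient.ind with | _ x =>
        induction b using Quotient.ind with | _ y =>
        obtain ⟨z, s, t, h1, h2⟩ := h.directed x y x.2 y.2
        exact ⟨Quotient.mk _ ⟨z, h.left _ _ _ h1⟩, s, t, ((smul_mk _ _ _).2 h1).symm,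
          ((smul_mk _ _ _).2 h2).symm⟩
      condP := by
        intro a b u v hab
        induction a using Quotient.ind with | _ x =>
        induction b using Quotient.ind with | _ y =>
        obtain ⟨z, hz⟩ := Quotient.exists_rep (op u • (Quotient.mk h.setoid x))
        obtain ⟨w, s, t, h1, h2, h3⟩ := h.condP x y z u v ((smul_mk _ _ _).1 hz.symm)
          ((smul_mk _ _ _).1 (hab.symm.trans hz.symm))
        exact ⟨Quotient.mk _ ⟨w, h.left _ _ _ h1⟩, s, t, ((smul_mk _ _ _).2 h1).symm,
          ((smul_mk _ _ _).2 h2).symm, h3⟩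
      condE := by
        intro he a u v hab
        induction a using Quotient.ind with | _ x =>
        obtain ⟨z, hz⟩ := Quotient.exists_rep (op u • (Quotient.mk h.setoid x))
        obtain ⟨w, s, h1, h3⟩ := h.condE he x z u v ((smul_mk _ _ _).1 hz.symm)
          ((smul_mk _ _ _).1 (hab.symm.trans hz.symm))
        exact ⟨Quotient.mk _ ⟨w, h.left _ _ _ h1⟩, s, ((smul_mk _ _ _).2 h1).symm, h3⟩ }
  refine ⟨Y, {x | R.1 1 x x}, fun x => if hx : R.1 1 x x then Quotient.mk h.setoid ⟨x, hx⟩ else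
    Quotient.mk h.setoid ⟨x₀, hx₀⟩, ⟨fun y => ?_, fun s x y => ?_, fun x a => ?_⟩⟩
  · induction y using Quotient.ind with | _ x => exact ⟨x, x.2, dif_pos x.2⟩
  · constructor
    · intro H
      have hx := h.left _ _ _ H
      have hy := h.right _ _ _ H
      refine ⟨hx, hy, ?_⟩
      rw [dif_pos hx, dif_pos hy]
      exact (smul_mk _ _ _).2 H
    · rintro ⟨hx, hy, H⟩
      rw [dif_pos (show R.1 1 x x from hx), dif_pos (show R.1 1 y y from hy)] at H
      exact (smul_mk s ⟨x, hx⟩ ⟨y, hy⟩).1 H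
  · constructor
    · intro H
      have hx := h.lab_dom _ _ H
      refine ⟨hx, ?_⟩
      rw [dif_pos hx]
      exact h.lab_unique x _ _ (hl x hx) H
    · rintro ⟨hx, H⟩
      rw [dif_pos (show R.1 1 x x from hx)] at H
      exact H ▸ hl x hx

lemma Presents.exists_hom (h : Presents R Y D π) (h' : Presents R' Y' D' π') (hle : R ≤ R') :
    ∃ f : Y.X → Y'.X, IsHom Y Y' f ∧ ∀ x ∈ D, f (π x) = π' x := by
  choose ν hν hπν using h.surj
  have hD : ∀ x ∈ D, x ∈ D' := fun x hx =>
    (h'.mem_iff x).2 (hle.1 _ _ _ ((h.mem_iff x).1 hx))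
  have key : ∀ x ∈ D, π' (ν (π x)) = π' x := fun x hx =>
    (h'.eq_iff (hD _ (hν _)) (hD _ hx)).1
      (hle.1 _ _ _ ((h.eq_iff (hν _) hx).2 (hπν _)))
  refine ⟨fun y => π' (ν y), ⟨fun s y => ?_, fun y => ?_⟩, key⟩
  · have := hle.1 s (ν y) (ν (op s • y)) ((h.act _ _ _).2 ⟨hν _, hν _, by rw [hπν, hπν]⟩)
    exact ((h'.act _ _ _).1 this).2.2.symm
  · have := hle.2 (ν y) (Y.g y) ((h.lab _ _).2 ⟨hν _, by rw [hπν]⟩)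
    exact ((h'.lab _ _).1 this).2

/-- The relations among labels given by a partial naming of the elements of an act. -/
def relsOf (Y : LocallyCyclicOver S A e) (D : Set U) (π : U → Y.X) : Rels S A U :=
  (fun s x y => x ∈ D ∧ y ∈ D ∧ op s • π x = π y, fun x a => x ∈ D ∧ Y.g (π x) = a)

lemma presents_relsOf (hsurj : ∀ y, ∃ x ∈ D, π x = y) : Presents (relsOf Y D π) Y D π :=
  ⟨hsurj, fun _ _ _ => Iff.rfl, fun _ _ => Iff.rfl⟩

lemma exists_presents_of_injective {k : Y.X → U} (hk : Injective k) :
    ∃ (R : Rels S A U) (π : U → Y.X), Presents R Y (Set.range k) π ∧ ∀ y, π (k y) = y := by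
  have := Y.nonempty
  have hl : ∀ y, invFun k (k y) = y := leftInverse_invFun hk
  exact ⟨_, invFun k, presents_relsOf fun y => ⟨k y, ⟨y, rfl⟩, hl y⟩, hl⟩

lemma Presents.exists_extension (h : Presents R Y D π) {f : Y.X → Y'.X} (hf : IsHom Y Y' f)
    {k : Y'.X → U} (hk : Injective k) (hkD : ∀ z, k z ∉ D) :
    ∃ (R' : Rels S A U) (π' : U → Y'.X), Presents R' Y' (D ∪ k '' (Set.range f)ᶜ) π' ∧
      R ≤ R' ∧ (∀ x ∈ D, π' x = f (π x)) ∧ ∀ z, π' (k z) = z := by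
  classical
  have := Y'.nonempty
  let π' : U → Y'.X := fun x => if x ∈ D then f (π x) else invFun k x
  have h1 : ∀ x ∈ D, π' x = f (π x) := fun x hx => if_pos hx
  have h2 : ∀ z, π' (k z) = z := fun z => (if_neg (hkD z)).trans (leftInverse_invFun hk z)
  refine ⟨relsOf Y' _ π', π', presents_relsOf fun z => ?_, ⟨fun s x y H => ?_, fun x a H => ?_⟩,
    h1, h2⟩
  · by_cases hz : z ∈ Set.range f
    · obtain ⟨y, rfl⟩ := hz
      obtain ⟨x, hx, rfl⟩ := h.surj y
      exact ⟨x, Or.inl hx, h1 x hx⟩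
    · exact ⟨k z, Or.inr ⟨z, hz, rfl⟩, h2 z⟩
  · obtain ⟨hx, hy, H⟩ := (h.act _ _ _).1 H
    exact ⟨Or.inl hx, Or.inl hy, by rw [h1 x hx, h1 y hy, ← hf.1, H]⟩
  · obtain ⟨hx, H⟩ := (h.lab _ _).1 H
    exact ⟨Or.inl hx, by rw [h1 x hx, hf.2, H]⟩

lemma sSup_rels_act {c : Set (Rels S A U)} {s : S} {x y : U} :
    (sSup c).1 s x y ↔ ∃ R ∈ c, R.1 s x y := by
  simp [Prod.fst_sSup, sSup_apply]

lemma sSup_rels_lab {c : Set (Rels S A U)} {x : U} {a : A} :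
    (sSup c).2 x a ↔ ∃ R ∈ c, R.2 x a := by
  simp only [Prod.snd_sSup, sSup_image, iSup_apply, iSup_Prop_eq, exists_prop]

lemma isPres_sSup {c : Set (Rels S A U)} (hc : IsChain (· ≤ ·) c) (hne : c.Nonempty)
    (h : ∀ R ∈ c, IsPres e R) : IsPres e (sSup c) := by
  have dir : ∀ R ∈ c, ∀ R' ∈ c, ∃ T ∈ c, R ≤ T ∧ R' ≤ T := fun R hR R' hR' =>
    hc.directedOn R hR R' hR'
  refine ⟨?_, ?_, ?_, ?_, ?_, ?_, ?_, ?_, ?_, ?_, ?_, ?_, ?_, ?_⟩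
  all_goals simp only [sSup_rels_act, sSup_rels_lab]
  · obtain ⟨R, hR⟩ := hne
    obtain ⟨x, hx⟩ := (h R hR).nonempty
    exact ⟨x, R, hR, hx⟩
  · rintro s x y ⟨R, hR, H⟩
    exact ⟨R, hR, (h R hR).left _ _ _ H⟩
  · rintro s x y ⟨R, hR, H⟩
    exact ⟨R, hR, (h R hR).right _ _ _ H⟩
  · rintro x y ⟨R, hR, H⟩
    exact ⟨R, hR, (h R hR).symm _ _ H⟩
  · rintro s x ⟨R, hR, H⟩
    obtain ⟨y, hy⟩ := (h R hR).total s _ H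
    exact ⟨y, R, hR, hy⟩
  · rintro s x y y' ⟨R, hR, H⟩ ⟨R', hR', H'⟩
    obtain ⟨T, hT, h1, h2⟩ := dir R hR R' hR'
    exact ⟨T, hT, (h T hT).unique s _ _ _ (h1.1 _ _ _ H) (h2.1 _ _ _ H')⟩
  · rintro s t x y z ⟨R, hR, H⟩ ⟨R', hR', H'⟩
    obtain ⟨T, hT, h1, h2⟩ := dir R hR R' hR'
    exact ⟨T, hT, (h T hT).comp _ _ _ _ _ (h1.1 _ _ _ H) (h2.1 _ _ _ H')⟩
  · rintro x a ⟨R, hR, H⟩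
    exact ⟨R, hR, (h R hR).lab_dom _ _ H⟩
  · rintro x ⟨R, hR, H⟩
    obtain ⟨a, ha⟩ := (h R hR).lab_total _ H
    exact ⟨a, R, hR, ha⟩
  · rintro x a b ⟨R, hR, H⟩ ⟨R', hR', H'⟩
    obtain ⟨T, hT, h1, h2⟩ := dir R hR R' hR'
    exact (h T hT).lab_unique _ _ _ (h1.2 _ _ H) (h2.2 _ _ H')
  · rintro s x y a ⟨R, hR, H⟩ ⟨R', hR', H'⟩
    obtain ⟨T, hT, h1, h2⟩ := dir R hR R' hR'
    exact ⟨T, hT, (h T hT).lab_act _ _ _ _ (h1.1 _ _ _ H) (h2.2 _ _ H')⟩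
  · rintro x y ⟨R, hR, H⟩ ⟨R', hR', H'⟩
    obtain ⟨T, hT, h1, h2⟩ := dir R hR R' hR'
    obtain ⟨z, s, t, hs, ht⟩ := (h T hT).directed _ _ (h1.1 _ _ _ H) (h2.1 _ _ _ H')
    exact ⟨z, s, t, ⟨T, hT, hs⟩, ⟨T, hT, ht⟩⟩
  · rintro x y z u v ⟨R, hR, H⟩ ⟨R', hR', H'⟩
    obtain ⟨T, hT, h1, h2⟩ := dir R hR R' hR'
    obtain ⟨w, s, t, hs, ht, hst⟩ := (h T hT).condP _ _ _ _ _ (h1.1 _ _ _ H) (h2.1 _ _ _ H')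
    exact ⟨w, s, t, ⟨T, hT, hs⟩, ⟨T, hT, ht⟩, hst⟩
  · rintro he x z u v ⟨R, hR, H⟩ ⟨R', hR', H'⟩
    obtain ⟨T, hT, h1, h2⟩ := dir R hR R' hR'
    obtain ⟨w, s, hs, hst⟩ := (h T hT).condE he _ _ _ _ (h1.1 _ _ _ H) (h2.1 _ _ _ H')
    exact ⟨w, s, ⟨T, hT, hs⟩, hst⟩

end Presentations

/-- Labels generated from `X` by adding, for every pair of labels, a copy of `K`. -/
inductive Labels (X K : Type u) : Type u
  | base (x : X) : Labels X K
  | new (p q : Labels X K) (a : K) : Labels X K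

lemma exists_monoSat {K : Type u}
    (hK : ∀ Y : LocallyCyclicOver S A e, ∃ f : Y.X → K, Injective f)
    (X : LocallyCyclicOver S A e) :
    ∃ (Y : LocallyCyclicOver S A e) (f : X.X → Y.X), IsHom X Y f ∧ MonoSat Y := by
  let V : Set (Rels S A (Labels X.X K)) :=
    {R | IsPres e R ∧ ∀ p q a, R.1 1 (.new p q a) (.new p q a) → R.1 1 p q}
  obtain ⟨R₀, π₀, h₀, -⟩ := exists_presents_of_injective (Y := X) (k := Labels.base (K := K))
    (fun x y h => by simpa using h)
  have hV₀ : R₀ ∈ V := by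
    refine ⟨h₀.isPres, fun p q a H => ?_⟩
    obtain ⟨x, hx⟩ := (h₀.mem_iff _).2 H
    cases hx
  obtain ⟨R, hle, hR⟩ := zorn_le_nonempty₀ V (by
    intro c hcV hc R hR
    refine ⟨sSup c, ⟨isPres_sSup hc ⟨R, hR⟩ fun T hT => (hcV hT).1, fun p q a H => ?_⟩,
      fun T hT => le_sSup hT⟩
    obtain ⟨T, hT, H⟩ := sSup_rels_act.1 H
    exact sSup_rels_act.2 ⟨T, hT, (hcV hT).2 _ _ _ H⟩) R₀ hV₀
  obtain ⟨Y, D, π, h⟩ := hR.prop.1.exists_presents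
  obtain ⟨f₀, hf₀, -⟩ := h₀.exists_hom h hle
  refine ⟨Y, f₀, hf₀, fun Z f hf y y' hyy' => ?_⟩
  by_contra hne
  obtain ⟨p, hp, rfl⟩ := h.surj y
  obtain ⟨q, hq, rfl⟩ := h.surj y'
  obtain ⟨i, hi⟩ := hK Z
  obtain ⟨R', π', h', hRR', hπ', -⟩ := h.exists_extension hf (k := fun z => Labels.new p q (i z))
    (fun a b hab => hi (by simpa using hab))
    (fun z hz => hne ((h.eq_iff hp hq).1 (hR.prop.2 _ _ _ ((h.mem_iff _).1 hz))))
  have hpq : R'.1 1 p q :=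
    (h'.eq_iff (Or.inl hp) (Or.inl hq)).2 (by rw [hπ' p hp, hπ' q hq, hyy'])
  have hV' : R' ∈ V := by
    refine ⟨h'.isPres, fun p' q' a H => ?_⟩
    rcases (h'.mem_iff _).2 H with H | ⟨z, -, hz⟩
    · exact hRR'.1 _ _ _ (hR.prop.2 _ _ _ ((h.mem_iff _).1 H))
    · cases hz
      exact hpq
  exact hne ((h.eq_iff hp hq).1 ((hR.le_of_ge hV' hRR').1 _ _ _ hpq))

lemma MonoSat.exists_isMaximal {K : Type u}
    (hK : ∀ Y : LocallyCyclicOver S A e, ∃ f : Y.X → K, Injective f)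
    {X : LocallyCyclicOver S A e} (hX : MonoSat X) :
    ∃ (Y : LocallyCyclicOver S A e) (f : X.X → Y.X), IsHom X Y f ∧ IsMaximal Y := by
  let V : Set (Rels S A (Set K × K)) :=
    {R | IsPres e R ∧ (∀ x y, R.1 1 x y → x = y) ∧
      ∀ (Y : LocallyCyclicOver S A e) (D : Set (Set K × K)) (π : Set K × K → Y.X),
        Presents R Y D π → MonoSat Y}
  have memV : ∀ {R : Rels S A (Set K × K)} {Y : LocallyCyclicOver S A e} {D : Set (Set K × K)}
      {π : Set K × K → Y.X}, Presents R Y D π → MonoSat Y → Set.InjOn π D → R ∈ V := by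
    intro R Y D π h hY hinj
    refine ⟨h.isPres, fun x y hxy => ?_, fun Z D' π' h' => ?_⟩
    · obtain ⟨hx, hy, H⟩ := (h.act _ _ _).1 hxy
      exact hinj hx hy (by simpa using H)
    · obtain ⟨f, hf, hfπ⟩ := h.exists_hom h' le_rfl
      refine hY.of_hom hf ⟨hY _ f hf, fun z => ?_⟩
      obtain ⟨x, hx, rfl⟩ := h'.surj z
      exact ⟨π x, hfπ x ((h.mem_iff x).2 ((h'.mem_iff x).1 hx))⟩
  obtain ⟨i₀, hi₀⟩ := hK X
  obtain ⟨R₀, π₀, h₀, hπ₀⟩ := exists_presents_of_injective (Y := X)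
    (k := fun x => ((∅ : Set K), i₀ x)) (fun x y h => hi₀ (by simpa using h))
  have hV₀ : R₀ ∈ V := by
    refine memV h₀ hX ?_
    rintro _ ⟨x, rfl⟩ _ ⟨y, rfl⟩ hxy
    rw [hπ₀, hπ₀] at hxy
    rw [hxy]
  obtain ⟨R, hle, hR⟩ := zorn_le_nonempty₀ V (by
    intro c hcV hc R hR
    refine ⟨sSup c, ⟨isPres_sSup hc ⟨R, hR⟩ fun T hT => (hcV hT).1, fun x y H => ?_, ?_⟩,
      fun T hT => le_sSup hT⟩
    · obtain ⟨T, hT, H⟩ := sSup_rels_act.1 H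
      exact (hcV hT).2.1 _ _ H
    · intro Y D π h Z f hf y y' hyy'
      obtain ⟨p, hp, rfl⟩ := h.surj y
      obtain ⟨q, hq, rfl⟩ := h.surj y'
      obtain ⟨T₁, hT₁, H₁⟩ := sSup_rels_act.1 ((h.mem_iff p).1 hp)
      obtain ⟨T₂, hT₂, H₂⟩ := sSup_rels_act.1 ((h.mem_iff q).1 hq)
      obtain ⟨T, hT, h1, h2⟩ := hc.directedOn T₁ hT₁ T₂ hT₂
      obtain ⟨W, D', π', h'⟩ := (hcV hT).1.exists_presents (e := e)
      have hp' := (h'.mem_iff p).2 (h1.1 _ _ _ H₁)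
      have hq' := (h'.mem_iff q).2 (h2.1 _ _ _ H₂)
      obtain ⟨j, hj, hjπ⟩ := h'.exists_hom h (le_sSup hT)
      have := (hcV hT).2.2 W D' π' h' Z (f ∘ j) (hf.comp hj) (a₁ := π' p) (a₂ := π' q)
        (by simp only [comp_apply, hjπ p hp', hjπ q hq', hyy'])
      rw [← hjπ p hp', ← hjπ q hq', this]) R₀ hV₀
  obtain ⟨Y, D, π, h⟩ := hR.prop.1.exists_presents
  obtain ⟨f₀, hf₀, -⟩ := h₀.exists_hom h hle
  have hY := hR.prop.2.2 Y D π h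
  refine ⟨Y, f₀, hf₀, hY, fun Z f hZ hf => ⟨hY Z f hf, fun z₀ => ?_⟩⟩
  by_contra hz₀
  have hinj : Set.InjOn π D := fun x hx y hy hxy =>
    hR.prop.2.1 _ _ ((h.eq_iff hx hy).2 hxy)
  obtain ⟨t, ht⟩ : ∃ t : Set K, ∀ a, (t, a) ∉ D := by
    by_contra! hcol
    choose a ha using hcol
    obtain ⟨i, hi⟩ := hK Y
    refine cantor_injective (fun t => i (π (t, a t))) fun t t' htt' => ?_
    exact congrArg Prod.fst (hinj (ha t) (ha t') (hi htt'))
  obtain ⟨i, hi⟩ := hK Z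
  obtain ⟨R', π', h', hRR', hπ', hπk⟩ := h.exists_extension hf (k := fun z => (t, i z))
    (fun a b hab => hi (by simpa using hab)) (fun z => ht _)
  have hV' : R' ∈ V := by
    refine memV h' hZ ?_
    rintro x (hx | ⟨z, hz, rfl⟩) y (hy | ⟨w, hw, rfl⟩) hxy
    · rw [hπ' x hx, hπ' y hy] at hxy
      exact hinj hx hy (hY Z f hf hxy)
    · rw [hπ' x hx, hπk] at hxy
      exact absurd ⟨_, hxy⟩ hw
    · rw [hπ' y hy, hπk] at hxy
      exact absurd ⟨_, hxy.symm⟩ hz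
    · rw [hπk, hπk] at hxy
      rw [hxy]
  have hz : R'.1 1 (t, i z₀) (t, i z₀) :=
    (h'.mem_iff _).1 (Or.inr ⟨z₀, by simpa using hz₀, rfl⟩)
  exact ht _ ((h.mem_iff _).2 ((hR.le_of_ge hV' hRR').1 _ _ _ hz))

/-- A set of representatives of the isomorphism classes of maximal objects. -/
lemma exists_representatives {K : Type u}
    (hK : ∀ Y : LocallyCyclicOver S A e, ∃ f : Y.X → K, Injective f) :
    ∃ (I : Type u) (M : I → LocallyCyclicOver S A e), (∀ i, IsMaximal (M i)) ∧
      (∀ i j f, IsHom (M i) (M j) f → i = j) ∧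
      ∀ X : LocallyCyclicOver S A e, ∃ i f, IsHom X (M i) f := by
  let T := {R : Rels S A K // ∃ (Y : LocallyCyclicOver S A e) (D : Set K) (π : K → Y.X),
    Presents R Y D π ∧ IsMaximal Y}
  choose N D π hN hmax using fun R : T => R.2
  let r : Setoid T :=
    { r := fun R R' => ∃ f, IsHom (N R) (N R') f ∧ Bijective f
      iseqv := ⟨fun R => ⟨id, ⟨fun _ _ => rfl, fun _ => rfl⟩, bijective_id⟩,
        fun ⟨f, hf, hb⟩ => hf.exists_inverse hb,
        fun ⟨f, hf, hb⟩ ⟨f', hf', hb'⟩ => ⟨f' ∘ f, hf'.comp hf, hb'.comp hb⟩⟩ }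
  refine ⟨Quotient r, fun i => N i.out, fun i => hmax _, fun i j f hf => ?_, fun X => ?_⟩
  · rw [← Quotient.out_eq i, ← Quotient.out_eq j]
    exact Quotient.sound ⟨f, hf, (hmax _).2 _ f (hmax _).1 hf⟩
  · obtain ⟨Y, f, hf, hY⟩ := exists_monoSat hK X
    obtain ⟨Z, f', hf', hZ⟩ := hY.exists_isMaximal hK
    obtain ⟨k, hk⟩ := hK Z
    obtain ⟨R, ρ, hR, -⟩ := exists_presents_of_injective hk
    let R₁ : T := ⟨R, Z, _, ρ, hR, hZ⟩
    obtain ⟨f₁, hf₁, -⟩ := hR.exists_hom (hN R₁) le_rfl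
    obtain ⟨f₂, hf₂, -⟩ : ∃ f, IsHom (N R₁) (N (Quotient.mk r R₁).out) f ∧ Bijective f :=
      r.symm (Quotient.mk_out (s := r) R₁)
    exact ⟨Quotient.mk r R₁, _, hf₂.comp (hf₁.comp (hf'.comp hf))⟩

end LocallyCyclicOver

/-- Two elements of an act satisfying condition (P) are in the same component if they lie in a
common cyclic subact. -/
def CondP.setoid {C : Type u} [MulAction Sᵐᵒᵖ C] (hP : CondP S C) : Setoid C where
  r x y := ∃ (z : C) (s t : S), x = op s • z ∧ y = op t • z
  iseqv :=
    { refl := fun x => ⟨x, 1, 1, by simp, by simp⟩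
      symm := fun ⟨z, s, t, hs, ht⟩ => ⟨z, t, s, ht, hs⟩
      trans := by
        rintro x y w ⟨z, s, t, rfl, rfl⟩ ⟨z', p, q, h, rfl⟩
        obtain ⟨c, a, b, rfl, rfl, -⟩ := hP _ _ _ _ h
        exact ⟨c, a * s, b * q, by rw [op_mul, mul_smul], by rw [op_mul, mul_smul]⟩ }

lemma CondP.mk_smul {C : Type u} [MulAction Sᵐᵒᵖ C] (hP : CondP S C) (s : S) (c : C) :
    Quotient.mk hP.setoid (op s • c) = Quotient.mk hP.setoid c :=
  Quotient.sound ⟨c, s, 1, rfl, by simp⟩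

open LocallyCyclicOver in
lemma CondP.exists_component {A : Type u} [MulAction Sᵐᵒᵖ A] {e : Prop} {C : Type u}
    [MulAction Sᵐᵒᵖ C] (hP : CondP S C) (hE : e → CondE S C) {g : C → A} (hg : IsSMap S g)
    (q : Quotient hP.setoid) :
    ∃ (Y : LocallyCyclicOver S A e) (f : {c : C // Quotient.mk hP.setoid c = q} → Y.X),
      (∀ (s : S) c h, f ⟨op s • c.1, h⟩ = op s • f c) ∧ ∀ c, Y.g (f c) = g c := by
  let _ : MulAction Sᵐᵒᵖ {c : C // Quotient.mk hP.setoid c = q} :=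
    { smul := fun s c => ⟨s • c.1, (hP.mk_smul s.unop c.1).trans c.2⟩
      one_smul := fun c => Subtype.ext (one_smul _ c.1)
      mul_smul := fun s t c => Subtype.ext (mul_smul s t c.1) }
  have mem : ∀ {c d : C} {s : S}, c = op s • d → Quotient.mk hP.setoid c = q →
      Quotient.mk hP.setoid d = q := by
    rintro _ d s rfl h
    exact (hP.mk_smul s d).symm.trans h
  refine ⟨⟨{c : C // Quotient.mk hP.setoid c = q}, fun c => g c, fun s c => hg s c.1, ?_, ?_, ?_,
    ?_⟩, id, fun s c h => rfl, fun c => rfl⟩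
  · obtain ⟨c, hc⟩ := Quotient.exists_rep q
    exact ⟨c, hc⟩
  · rintro ⟨x, hx⟩ ⟨y, hy⟩
    obtain ⟨z, s, t, h1, h2⟩ := Quotient.exact (hx.trans hy.symm)
    exact ⟨⟨z, mem h1 hx⟩, s, t, Subtype.ext h1, Subtype.ext h2⟩
  · rintro ⟨x, hx⟩ ⟨y, hy⟩ u v huv
    obtain ⟨z, s, t, h1, h2, h3⟩ := hP x y u v (congrArg Subtype.val huv)
    exact ⟨⟨z, mem h1 hx⟩, s, t, Subtype.ext h1, Subtype.ext h2, h3⟩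
  · rintro he ⟨x, hx⟩ u v huv
    obtain ⟨z, s, h1, h3⟩ := hE he x u v (congrArg Subtype.val huv)
    exact ⟨⟨z, mem h1 hx⟩, s, Subtype.ext h1, h3⟩

open LocallyCyclicOver in
lemma hasCover_condP_and_imp_condE (hS : ∀ s : S, ∃ k : ℕ, ∀ m : S,
      {p : S | p * s = m}.Finite ∧ {p : S | p * s = m}.ncard ≤ k)
    (A : Type u) [MulAction Sᵐᵒᵖ A] (e : Prop) :
    HasCover S (fun (B : Type u) [MulAction Sᵐᵒᵖ B] => CondP S B ∧ (e → CondE S B)) A := by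
  obtain ⟨I, M, hmax, huniq, hex⟩ := exists_representatives
    (exists_injective hS (A := A) (e := e))
  have smul_mk : ∀ (s : S) (i : I) (x : (M i).X),
      op s • (⟨i, x⟩ : Σ i, (M i).X) = ⟨i, op s • x⟩ := fun _ _ _ => rfl
  refine ⟨Σ i, (M i).X, inferInstance, fun c => (M c.1).g c.2, ⟨⟨?_, ?_⟩, fun s c => (M c.1).map_g s c.2, ?_⟩,
    ?_⟩
  · rintro ⟨i, x⟩ ⟨j, y⟩ u v h
    obtain rfl : i = j := congrArg Sigma.fst h
    obtain ⟨z, s, t, rfl, rfl, h3⟩ := (M i).condP x y u v (by simpa [smul_mk] using h)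
    exact ⟨⟨i, z⟩, s, t, rfl, rfl, h3⟩
  · rintro he ⟨i, x⟩ u v h
    obtain ⟨z, s, rfl, h3⟩ := (M i).condE he x u v (by simpa [smul_mk] using h)
    exact ⟨⟨i, z⟩, s, rfl, h3⟩
  · rintro C _ ⟨hP, hE⟩ g hg
    have hcomp : ∀ q : Quotient hP.setoid,
        ∃ (i : I) (f : {c : C // Quotient.mk hP.setoid c = q} → (M i).X),
          (∀ (s : S) c h, f ⟨op s • c.1, h⟩ = op s • f c) ∧ ∀ c, (M i).g (f c) = g c := by
      intro q
      obtain ⟨Y, f, hf, hfg⟩ := hP.exists_component hE hg q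
      obtain ⟨i, f', hf'⟩ := hex Y
      exact ⟨i, f' ∘ f, fun s c h => by simp [hf, hf'.1 s], fun c => by simp [hf'.2, hfg]⟩
    choose i f hf hfg using hcomp
    have key : ∀ c q (hq : Quotient.mk hP.setoid c = q),
        (⟨i _, f _ ⟨c, rfl⟩⟩ : Σ i, (M i).X) = ⟨i q, f q ⟨c, hq⟩⟩ := by
      rintro c _ rfl
      rfl
    refine ⟨fun c => ⟨i _, f (Quotient.mk hP.setoid c) ⟨c, rfl⟩⟩, fun s c => ?_,
      fun c => hfg _ ⟨c, rfl⟩⟩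
    change (⟨i _, f (Quotient.mk hP.setoid (op s • c)) ⟨op s • c, rfl⟩⟩ : Σ i, (M i).X) = _
    rw [key (op s • c) _ (hP.mk_smul s c), hf _ s ⟨c, rfl⟩]
    rfl
  · intro f hf hfg
    have hstep : ∀ i, ∃ h : (M i).X → (M i).X, Bijective h ∧ ∀ x, f ⟨i, x⟩ = ⟨i, h x⟩ := by
      intro i
      obtain ⟨x₀⟩ := (M i).nonempty
      have hconst : ∀ x, ∃ y, f ⟨i, x⟩ = ⟨(f ⟨i, x₀⟩).1, y⟩ := by
        intro x
        obtain ⟨z, s, t, rfl, hz⟩ := (M i).directed x x₀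
        rw [hz, ← smul_mk, ← smul_mk, hf, hf]
        exact ⟨_, rfl⟩
      generalize (f ⟨i, x₀⟩).1 = j at hconst
      choose h hh using hconst
      have hhom : IsHom (M i) (M j) h := by
        refine ⟨fun s x => ?_, fun x => ?_⟩
        · have := hf s ⟨i, x⟩
          rw [smul_mk, hh, hh, smul_mk] at this
          simpa using this
        · have := hfg ⟨i, x⟩
          rwa [hh] at this
      obtain rfl := huniq i j h hhom
      exact ⟨h, (hmax i).2 _ h (hmax i).1 hhom, hh⟩
    choose h hb hh using hstep
    constructor
    · rintro ⟨i, x⟩ ⟨j, y⟩ hxy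
      rw [hh, hh] at hxy
      obtain rfl : i = j := congrArg Sigma.fst hxy
      rw [(hb i).1 (a₁ := x) (a₂ := y) (by simpa using hxy)]
    · rintro ⟨i, y⟩
      obtain ⟨x, rfl⟩ := (hb i).2 y
      exact ⟨⟨i, x⟩, hh i x⟩

end CoverConstruction

/-- If for every `s ∈ S` there is `k ∈ ℕ` such that every equation
`p * s = m` has at most `k` solutions `p`, then every right `S`-act has a strongly flat
cover and a condition (P) cover. -/
theorem hasCover_stronglyFlat_and_condP_of_finite_type
    (hS : ∀ s : S, ∃ k : ℕ, ∀ m : S,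
      {p : S | p * s = m}.Finite ∧ {p : S | p * s = m}.ncard ≤ k)
    (A : Type u) [MulAction Sᵐᵒᵖ A] :
    HasCover S (fun (B : Type u) [MulAction Sᵐᵒᵖ B] => CondP S B ∧ CondE S B) A ∧
      HasCover S (fun (B : Type u) [MulAction Sᵐᵒᵖ B] => CondP S B) A := by
  exact ⟨by simpa using hasCover_condP_and_imp_condE hS A True,
    by simpa using hasCover_condP_and_imp_condE hS A False⟩
end

section
/- Let S be the monoid of all functions ℕ → ℕ, with multiplication s*t = 'apply s then t' (so that composition of right actions works out), and let X be a nonempty type. Let A_X be the set of all functions X → ℕ, made into a right S-act by (f•s)(x) = s(f(x)). Then A_X is locally cyclic, satisfies condition (P) and satisfies condition (E) (hence is strongly flat and indecomposable), and the cardinality of A_X is at least the cardinality of X. -/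
open MulOpposite Function

universe u v

variable (S : Type u) [Monoid S]

/-- A right `S`-act `A` is locally cyclic. -/
def LocallyCyclic (A : Type v) [MulAction Sᵐᵒᵖ A] : Prop :=
  ∀ x y : A, ∃ (z : A) (s t : S), x = op s • z ∧ y = op t • z

/-- The monoid of all functions `ℕ → ℕ` with multiplication
`s * t = "apply s then t" = t ∘ s`. -/
def TransMonoid : Type :=
  ℕ → ℕ

instance : Monoid TransMonoid where
  mul s t := t ∘ s
  one := (id : ℕ → ℕ)
  mul_assoc _ _ _ := rfl
  one_mul _ := rfl
  mul_one _ := rfl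

/-- The right `TransMonoid`-act of all functions `X → ℕ`, where `(f • s) x = s (f x)`. -/
instance (X : Type u) : MulAction TransMonoidᵐᵒᵖ (X → ℕ) where
  smul s f := (s.unop : ℕ → ℕ) ∘ f
  one_smul _ := rfl
  mul_smul _ _ _ := rfl

/-- Two functions `a a' : X → ℕ` both factor through a common `z : X → ℕ`, as
`a = (a ∘ r) ∘ z` and `a' = (a' ∘ r) ∘ z` for a single function `r : ℕ → X`. -/
theorem exists_common_factor {X : Type*} [Nonempty X] (a a' : X → ℕ) :
    ∃ (z : X → ℕ) (r : ℕ → X), (∀ x, a (r (z x)) = a x) ∧ ∀ x, a' (r (z x)) = a' x := by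
  let z : X → ℕ := fun x => Nat.pair (a x) (a' x)
  have hz (x : X) : z (invFun z (z x)) = z x := invFun_eq ⟨x, rfl⟩
  exact ⟨z, invFun z, fun x => (Nat.pair_eq_pair.1 (hz x)).1,
    fun x => (Nat.pair_eq_pair.1 (hz x)).2⟩

/-- For any nonempty type `X`, the right act `A_X` of all functions
`X → ℕ` over the full transformation monoid of `ℕ` is locally cyclic, satisfies
conditions (P) and (E) (hence is strongly flat and indecomposable), and has cardinality
at least that of `X`. -/
theorem transMonoid_act_stronglyFlat_locallyCyclic (X : Type u) [Nonempty X] :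
    LocallyCyclic TransMonoid (X → ℕ) ∧ CondP TransMonoid (X → ℕ) ∧
      CondE TransMonoid (X → ℕ) ∧ Cardinal.mk X ≤ Cardinal.mk (X → ℕ) := by
  refine ⟨fun a a' => ?_, fun a a' u u' h => ?_, fun a u u' h => ?_, ?_⟩
  · obtain ⟨z, r, hr, hr'⟩ := exists_common_factor a a'
    exact ⟨z, a ∘ r, a' ∘ r, funext fun x => (hr x).symm, funext fun x => (hr' x).symm⟩
  · obtain ⟨z, r, hr, hr'⟩ := exists_common_factor a a'
    exact ⟨z, a ∘ r, a' ∘ r, funext fun x => (hr x).symm, funext fun x => (hr' x).symm,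
      funext fun n => congrFun h (r n)⟩
  · obtain ⟨z, r, hr, -⟩ := exists_common_factor a a
    exact ⟨z, a ∘ r, funext fun x => (hr x).symm, funext fun n => congrFun h (r n)⟩
  · classical
    exact Cardinal.mk_le_of_injective (f := fun x : X => (Pi.single x 1 : X → ℕ))
      fun x y h => by simpa [Pi.single_apply] using congrFun h x
end
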